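/- Let k ≥ 6 be even, set t = (k-2)/2, and let F be a graph with p(F) ≥ t+1. Suppose that every graph in EX(t,𝓗) (the set of t-vertex 𝓗-free graphs with ex(t,𝓗) edges) contains some member of 𝓗' = {F − {u,v} : uv ∈ E(F)} as a subgraph. Then there exists N = N(k,F) such that for all n ≥ N, the maximum number of edges in an n-vertex 2-connected graph that is both 𝓒_{≥k}-free and F-free equals exactly ex(t,𝓗) + t(n - t). -/

import Mathlib

open SimpleGraph

section Defs

variable {V α β : Type*}

/-- `G` contains a copy of `F` as a (not necessarily induced) subgraph. -/
def ContainsCopy (F : SimpleGraph α) (G : SimpleGraph β) : Prop :=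
  ∃ f : α → β, Function.Injective f ∧ ∀ ⦃a b⦄, F.Adj a b → G.Adj (f a) (f b)

/-- The number of edges of `G`. -/
noncomputable def edgeCount (G : SimpleGraph V) : ℕ := G.edgeSet.ncard

/-- `G` has a cycle of length at least `k`, i.e. `G` is not `𝓒_{≥k}`-free. -/
def HasCycleGE (G : SimpleGraph V) (k : ℕ) : Prop :=
  ∃ (v : V) (w : G.Walk v v), w.IsCycle ∧ k ≤ w.length

/-- `G` is 2-connected: it has at least 3 vertices, is connected, and stays
connected after deleting any single vertex. -/
def TwoConnected [Fintype V] (G : SimpleGraph V) : Prop :=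
  3 ≤ Fintype.card V ∧ G.Connected ∧ ∀ v : V, (G.induce ({v}ᶜ : Set V)).Connected

/-- `p(F) ≥ s`: for every proper 2-coloring of `F` both color classes have size
at least `s` (vacuously true for nonbipartite `F`, where `p(F) = ∞`). -/
def PGE [Fintype α] (F : SimpleGraph α) (s : ℕ) : Prop :=
  ∀ c : α → Bool, (∀ a b, F.Adj a b → c a ≠ c b) →
    s ≤ {a | c a = true}.ncard ∧ s ≤ {a | c a = false}.ncard

/-- `S` is a vertex covering of `F`: the complement of `S` is independent. -/
def IsVertexCovering (F : SimpleGraph α) (S : Set α) : Prop :=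
  ∀ a b, a ∉ S → b ∉ S → ¬ F.Adj a b

/-- `G` is `𝓗`-free, where `𝓗 = {F[S] : S is a vertex covering of F}`. -/
def CoverFree (F : SimpleGraph α) (G : SimpleGraph β) : Prop :=
  ∀ S : Set α, IsVertexCovering F S → ¬ ContainsCopy (F.induce S) G

/-- The maximum number of edges of an `n`-vertex graph satisfying `P`
(a generic Turán-type extremal number). -/
noncomputable def exMax (n : ℕ) (P : SimpleGraph (Fin n) → Prop) : ℕ :=
  sSup {m | ∃ G : SimpleGraph (Fin n), P G ∧ edgeCount G = m}

/-- The number of edges of `G` with both endpoints in `T`, i.e. `e(G[T])`. -/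
noncomputable def edgesWithin (G : SimpleGraph V) (T : Set V) : ℕ :=
  {e ∈ G.edgeSet | ∀ x ∈ e, x ∈ T}.ncard

/-- The number of edges of `G` with both endpoints outside `T`, i.e. `e(G−T)`. -/
noncomputable def edgesOutside (G : SimpleGraph V) (T : Set V) : ℕ :=
  {e ∈ G.edgeSet | ∀ x ∈ e, x ∉ T}.ncard

/-- The number of edges of `G` with exactly one endpoint in `T`, i.e. `e(G−T, T)`. -/
noncomputable def edgesCross (G : SimpleGraph V) (T : Set V) : ℕ :=
  {e ∈ G.edgeSet | ∃ a b, e = s(a, b) ∧ a ∈ T ∧ b ∉ T}.ncard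

/-- The number of neighbors of `u` lying in `T` (e.g. `d_C(u)` for `T = V(C)`). -/
noncomputable def degOn (G : SimpleGraph V) (T : Set V) (u : V) : ℕ :=
  {x ∈ T | G.Adj u x}.ncard

/-- The join `T ∨ I_b` of a graph `T` on `Fin a` with an independent set of
`b` vertices. -/
def joinIndep (a b : ℕ) (T : SimpleGraph (Fin a)) : SimpleGraph (Fin a ⊕ Fin b) :=
  SimpleGraph.fromRel (fun x y =>
    x.isLeft ≠ y.isLeft ∨ ∃ u v, x = Sum.inl u ∧ y = Sum.inl v ∧ T.Adj u v)

end Defs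



section Paths

variable {V : Type*} {G : SimpleGraph V}

/-- `l` is (the vertex list of) a path of `G` from `u` to `v`. -/
structure LP (G : SimpleGraph V) (u v : V) (l : List V) : Prop where
  chain : l.IsChain G.Adj
  nodup : l.Nodup
  head : l.head? = some u
  last : l.getLast? = some v

theorem LP.ne_nil {u v : V} {l : List V} (h : LP G u v l) : l ≠ [] := by
  have := h.head
  rintro rfl
  simp at this

theorem LP.head_mem {u v : V} {l : List V} (h : LP G u v l) : u ∈ l :=
  List.mem_of_head? h.head

theorem LP.last_mem {u v : V} {l : List V} (h : LP G u v l) : v ∈ l :=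
  List.mem_of_getLast? h.last

theorem LP.sing (u : V) : LP G u u [u] := ⟨by simp, by simp, by simp, by simp⟩

theorem LP.rev {u v : V} {l : List V} (h : LP G u v l) : LP G v u l.reverse := by
  refine ⟨?_, by simpa using h.nodup, by simpa using h.last, by simpa using h.head⟩
  rw [List.isChain_reverse]
  exact h.chain.imp (fun a b hab => hab.symm)

theorem LP.join {u v u' v' : V} {l l' : List V} (h : LP G u v l) (h' : LP G u' v' l')
    (hadj : G.Adj v u') (hd : ∀ x ∈ l, x ∉ l') : LP G u v' (l ++ l') := by
  refine ⟨?_, ?_, ?_, ?_⟩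
  · apply h.chain.append h'.chain
    intro x hx y hy
    rw [h.last] at hx
    rw [h'.head] at hy
    simp at hx hy
    subst hx hy
    exact hadj
  · rw [List.nodup_append]
    refine ⟨h.nodup, h'.nodup, ?_⟩
    rintro a ha b hb rfl
    exact hd a ha hb
  · rw [List.head?_append, h.head]; simp
  · rw [List.getLast?_append, h'.last]; simp

theorem LP.cons {u v w : V} {l : List V} (h : LP G u v l) (hadj : G.Adj w u) (hw : w ∉ l) :
    LP G w v (w :: l) := by
  have := (LP.sing (G := G) w).join h hadj (by simpa using hw)
  simpa using this

theorem LP.left_of_append {u v : V} {l1 l2 : List V} {x : V} (h : LP G u v (l1 ++ x :: l2)) :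
    LP G u x (l1 ++ [x]) := by
  have e : l1 ++ x :: l2 = (l1 ++ [x]) ++ l2 := by simp
  refine ⟨?_, ?_, ?_, by simp⟩
  · have := h.chain
    rw [e] at this
    exact this.left_of_append
  · have := h.nodup
    rw [e] at this
    exact this.of_append_left
  · have := h.head
    rw [List.head?_append] at this ⊢
    simpa using this

theorem LP.right_of_append {u v : V} {l1 l2 : List V} {x : V} (h : LP G u v (l1 ++ x :: l2)) :
    LP G x v (x :: l2) := by
  refine ⟨h.chain.right_of_append, h.nodup.of_append_right, by simp, ?_⟩
  have := h.last
  rw [List.getLast?_append] at this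
  simpa [List.getLast?_cons] using this

theorem LP.split {u v : V} {l : List V} (h : LP G u v l) {x : V} (hx : x ∈ l) :
    ∃ l1 l2, l = l1 ++ x :: l2 ∧ LP G u x (l1 ++ [x]) ∧ LP G x v (x :: l2) := by
  obtain ⟨l1, l2, rfl⟩ := List.append_of_mem hx
  exact ⟨l1, l2, rfl, h.left_of_append, h.right_of_append⟩

theorem LP.eq_cons {u v : V} {l : List V} (h : LP G u v l) : ∃ l', l = u :: l' := by
  have := h.head
  cases l with
  | nil => simp at this
  | cons a l => simp at this; subst this; exact ⟨l, rfl⟩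

theorem LP.eq_concat {u v : V} {l : List V} (h : LP G u v l) : ∃ l', l = l' ++ [v] := by
  obtain ⟨l', h'⟩ := h.rev.eq_cons
  refine ⟨l'.reverse, ?_⟩
  have := congrArg List.reverse h'
  simpa using this

theorem LP.tail {u w v : V} {l : List V} (h : LP G u v (u :: w :: l)) :
    LP G w v (w :: l) ∧ G.Adj u w ∧ u ∉ w :: l := by
  refine ⟨(LP.right_of_append (l1 := [u]) h), ?_, ?_⟩
  · exact h.chain.rel
  · exact (List.nodup_cons.1 h.nodup).1

/-- concatenation of two paths sharing only the middle vertex -/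
theorem LP.trans' {u v w : V} {l m : List V} (h : LP G u v l) (h' : LP G v w (v :: m))
    (hd : ∀ x ∈ m, x ∉ l) : LP G u w (l ++ m) := by
  cases m with
  | nil =>
    have := h'.last
    simp at this
    subst this
    simpa using h
  | cons a m =>
    obtain ⟨h1, h2, h3⟩ := h'.tail
    exact h.join h1 h2 (fun x hx hx' => hd x hx' hx)

theorem LP.hasCycle {u v : V} {l : List V} (h : LP G u v l) (hadj : G.Adj v u)
    (hl : 3 ≤ l.length) {k : ℕ} (hk : k ≤ l.length) : HasCycleGE G k := by
  classical
  obtain ⟨hc, hn, hh, hla⟩ := h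
  have hne : l ≠ [] := by rintro rfl; simp at hl
  let p := Walk.ofSupport l hne hc
  have hp : p.IsPath := by
    rw [Walk.isPath_def]
    simpa [p, Walk.support_ofSupport] using hn
  have e1 : l.head hne = u := by
    have := List.head?_eq_some_head hne
    rw [hh] at this
    simpa using this.symm
  have e2 : l.getLast hne = v := by
    have := List.getLast?_eq_some_getLast hne
    rw [hla] at this
    simpa using this.symm
  have hadj' : G.Adj (l.getLast hne) (l.head hne) := by rw [e1, e2]; exact hadj
  have hlen : p.length = l.length - 1 := Walk.length_ofSupport hne hc
  refine ⟨_, Walk.cons hadj' p, ?_, ?_⟩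
  · rw [Walk.cons_isCycle_iff]
    refine ⟨hp, ?_⟩
    intro he
    have := hp.length_eq_one_of_mem_edges (by rwa [Sym2.eq_swap] at he)
    omega
  · simp [hlen]; omega

theorem HasCycleGE.exists_list {k : ℕ} (h : HasCycleGE G k) :
    ∃ u v l, LP G u v l ∧ G.Adj v u ∧ 3 ≤ l.length ∧ k ≤ l.length := by
  obtain ⟨v, w, hw, hk⟩ := h
  have h3 := hw.three_le_length
  cases w with
  | nil => simp at h3
  | cons hadj p =>
    rename_i u
    rw [Walk.cons_isCycle_iff] at hw
    have hl : p.support.length = p.length + 1 := p.length_support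
    simp at h3 hk
    refine ⟨u, v, p.support, ⟨p.isChain_adj_support, hw.1.support_nodup, ?_, ?_⟩, hadj, ?_, ?_⟩
    · rw [List.head?_eq_some_head p.support_ne_nil]; simp
    · rw [List.getLast?_eq_some_getLast p.support_ne_nil]; simp
    · omega
    · omega

theorem Walk.exists_LP {u v : V} (p : G.Walk u v) : ∃ l, LP G u v l ∧ ∀ x ∈ l, x ∈ p.support := by
  classical
  refine ⟨p.bypass.support, ⟨p.bypass.isChain_adj_support, p.bypass_isPath.support_nodup, ?_, ?_⟩, ?_⟩
  · rw [List.head?_eq_some_head p.bypass.support_ne_nil]; simp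
  · rw [List.getLast?_eq_some_getLast p.bypass.support_ne_nil]; simp
  · intro x hx; exact p.support_bypass_subset_support hx

theorem LP_of_induce {S : Set V} {u v : V} (hu : u ∈ S) (hv : v ∈ S)
    (h : (G.induce S).Reachable ⟨u, hu⟩ ⟨v, hv⟩) : ∃ l, LP G u v l ∧ ∀ x ∈ l, x ∈ S := by
  obtain ⟨p⟩ := h
  obtain ⟨l, hl, hs⟩ := Walk.exists_LP (p.map (Embedding.induce S).toHom)
  refine ⟨l, hl, ?_⟩
  intro x hx
  have := hs x hx
  rw [Walk.support_map] at this
  simp at this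
  obtain ⟨hx, -⟩ := this
  exact hx

/-- first hit of a set: a prefix meeting `B` exactly in its last vertex -/
theorem LP.firstHit {u v : V} {l : List V} (h : LP G u v l) (B : Set V) (hB : ∃ x ∈ l, x ∈ B) :
    ∃ l1 x, x ∈ B ∧ LP G u x (l1 ++ [x]) ∧ (∀ y ∈ l1, y ∉ B) ∧ ∃ l2, l = l1 ++ x :: l2 := by
  induction l generalizing u with
  | nil => simp at hB
  | cons a l ih =>
    have ha : a = u := by simpa using h.head
    subst ha
    by_cases haB : a ∈ B
    · exact ⟨[], a, haB, LP.sing a, by simp, l, rfl⟩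
    · cases l with
      | nil => simp at hB; exact absurd hB haB
      | cons b l =>
        obtain ⟨h1, h2, h3⟩ := h.tail
        obtain ⟨l1, x, hx, hl1, hy, l2, e⟩ := ih h1 (by
          obtain ⟨x, hx, hxB⟩ := hB
          rcases List.mem_cons.1 hx with rfl | hx
          · exact absurd hxB haB
          · exact ⟨x, hx, hxB⟩)
        refine ⟨a :: l1, x, hx, ?_, ?_, l2, by simp [e]⟩
        · refine hl1.cons h2 ?_
          intro hm
          apply h3
          rw [e]
          simp at hm ⊢
          tauto
        · simpa using ⟨haB, hy⟩

/-- last hit of a set: a suffix meeting `A` exactly in its first vertex -/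
theorem LP.lastHit {u v : V} {l : List V} (h : LP G u v l) (A : Set V) (hA : ∃ x ∈ l, x ∈ A) :
    ∃ l2 x, x ∈ A ∧ LP G x v (x :: l2) ∧ (∀ y ∈ l2, y ∉ A) ∧ ∃ l1, l = l1 ++ x :: l2 := by
  obtain ⟨l1, x, hx, h1, h2, l2, e⟩ := h.rev.firstHit A (by simpa using hA)
  refine ⟨l1.reverse, x, hx, by simpa using h1.rev, by simpa using h2, l2.reverse, ?_⟩
  have := congrArg List.reverse e
  simpa using this

end Paths


section Menger

variable {V : Type*} {G : SimpleGraph V}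

/-- `l` is a path from `a ∈ A` to `b ∈ B` meeting `A` only in `a` and `B` only in `b`. -/
structure ABP (G : SimpleGraph V) (A B : Set V) (a b : V) (l : List V) : Prop where
  lp : LP G a b l
  ha : a ∈ A
  hb : b ∈ B
  onlyA : ∀ x ∈ l, x ∈ A → x = a
  onlyB : ∀ x ∈ l, x ∈ B → x = b

theorem LP.toABP {u v : V} {l : List V} (h : LP G u v l) {A B : Set V} (hu : u ∈ A) (hv : v ∈ B) :
    ∃ a b l', ABP G A B a b l' ∧ ∀ x ∈ l', x ∈ l := by
  obtain ⟨l2, x, hx, h1, h2, l1, e⟩ := h.lastHit A ⟨u, h.head_mem, hu⟩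
  obtain ⟨l3, y, hy, h3, h4, l4, e'⟩ := h1.firstHit B ⟨v, h1.last_mem, hv⟩
  refine ⟨x, y, l3 ++ [y], ⟨h3, hx, hy, ?_, ?_⟩, ?_⟩
  · intro z hz hzA
    have : z ∈ x :: l2 := by rw [e']; simp at hz ⊢; tauto
    rcases List.mem_cons.1 this with rfl | hz'
    · rfl
    · exact absurd hzA (h2 z hz')
  · intro z hz hzB
    simp at hz
    rcases hz with hz | rfl
    · exact absurd hzB (h4 z hz)
    · rfl
  · intro z hz
    have : z ∈ x :: l2 := by rw [e']; simp at hz ⊢; tauto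
    rw [e]; simp at this ⊢; tauto

/-- extend an `A`-`B'` path ending in `x` by a path inside `B'` -/
theorem ABP.extend {A B B' : Set V} {a x b : V} {Q m : List V} (hQ : ABP G A B' a x Q)
    (hm : LP G x b (x :: m)) (hsub : ∀ y ∈ m, y ∈ B') (hBB : B ⊆ B') (hb : b ∈ B)
    (hmA : ∀ y ∈ m, y ∉ A) (hmB : ∀ y ∈ x :: m, y ∈ B → y = b) : ABP G A B a b (Q ++ m) := by
  have hnd : x ∉ m := (List.nodup_cons.1 hm.nodup).1
  refine ⟨hQ.lp.trans' hm ?_, hQ.ha, hb, ?_, ?_⟩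
  · intro y hy hyQ
    have := hQ.onlyB y hyQ (hsub y hy)
    subst this
    exact hnd hy
  · intro y hy hyA
    rcases List.mem_append.1 hy with h | h
    · exact hQ.onlyA y h hyA
    · exact absurd hyA (hmA y h)
  · intro y hy hyB
    rcases List.mem_append.1 hy with h | h
    · have := hQ.onlyB y h (hBB hyB)
      subst this
      exact hmB y (by simp) hyB
    · exact hmB y (by simp [h]) hyB

theorem aug [Finite V] (A : Set V) : ∀ (n : ℕ) (B : Set V), (Bᶜ).ncard = n → ∀ (a b : V) (P : List V),
    ABP G A B a b P →
    (∀ v, ∃ u ∈ A, ∃ w ∈ B, ∃ l, LP G u w l ∧ v ∉ l) →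
    ∃ a' b1 b2 Q1 Q2, ABP G A B a b1 Q1 ∧ ABP G A B a' b2 Q2 ∧ (∀ x ∈ Q1, x ∉ Q2) ∧
      (b = b1 ∨ b = b2) := by
  intro n
  induction n using Nat.strong_induction_on with
  | _ n ih =>
  intro B hn a b P hP hyp
  obtain ⟨u, hu, w, hw, l, hl, hbl⟩ := hyp b
  obtain ⟨r, s, R, hR, hRl⟩ := hl.toABP hu hw
  have hbR : b ∉ R := fun h => hbl (hRl b h)
  by_cases hdis : ∃ x ∈ R, x ∈ {x | x ∈ P}
  swap
  · push Not at hdis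
    exact ⟨r, b, s, P, R, hP, hR, fun x hx hx' => hdis x hx' hx, Or.inl rfl⟩
  obtain ⟨r2, x, hxP, hr2, hr2P, r1, eR⟩ := hR.lp.lastHit _ hdis
  simp only [Set.mem_ofPred_eq] at hxP hr2P
  obtain ⟨p1, p2, eP, hp1, hp2⟩ := hP.lp.split hxP
  have hxR : x ∈ R := by rw [eR]; simp
  have hxB : x ∉ B := by
    intro h
    have := hP.onlyB x hxP h
    subst this
    exact hbR hxR
  have hp2P : ∀ y ∈ p2, y ∈ P := by intro y hy; rw [eP]; simp [hy]
  have hp1P : ∀ y ∈ p1, y ∈ P := by intro y hy; rw [eP]; simp [hy]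
  have hr2R : ∀ y ∈ r2, y ∈ R := by intro y hy; rw [eR]; simp [hy]
  have hPnd := hP.lp.nodup
  rw [eP] at hPnd
  have hRnd := hR.lp.nodup
  rw [eR] at hRnd
  have hp2A : ∀ y ∈ p2, y ∉ A := by
    intro y hy hyA
    have h1 := hP.onlyA y (hp2P y hy) hyA
    subst h1
    have hh := hP.lp.head
    rw [eP] at hh
    cases p1 with
    | nil =>
      simp at hh
      subst hh
      simp at hPnd
      exact hPnd.1 hy
    | cons c p1 =>
      simp at hh
      subst hh
      simp at hPnd
      tauto
  have hr2A : ∀ y ∈ r2, y ∉ A := by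
    intro y hy hyA
    have h1 := hR.onlyA y (hr2R y hy) hyA
    subst h1
    have hh := hR.lp.head
    rw [eR] at hh
    cases r1 with
    | nil =>
      simp at hh
      subst hh
      simp at hRnd
      exact hRnd.1 hy
    | cons c p1 =>
      simp at hh
      subst hh
      simp at hRnd
      tauto
  set B' : Set V := B ∪ {x} ∪ {y | y ∈ p2} ∪ {y | y ∈ r2} with hB'
  have hBB : B ⊆ B' := by intro y hy; simp [hB', hy]
  have hxB' : x ∈ B' := by simp [hB']
  have hp2B' : ∀ y ∈ p2, y ∈ B' := by intro y hy; simp [hB', hy]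
  have hr2B' : ∀ y ∈ r2, y ∈ B' := by intro y hy; simp [hB', hy]
  have hlt : (B'ᶜ).ncard < n := by
    rw [← hn]
    apply Set.ncard_lt_ncard ?_ (Set.toFinite _)
    exact ⟨Set.compl_subset_compl.2 hBB, fun h => h (show x ∈ Bᶜ from hxB) hxB'⟩
  have hP' : ABP G A B' a x (p1 ++ [x]) := by
    refine ⟨hp1, hP.ha, hxB', ?_, ?_⟩
    · intro y hy hyA
      apply hP.onlyA y _ hyA
      simp at hy
      rcases hy with hy | rfl
      · exact hp1P y hy
      · exact hxP
    · intro y hy hyB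
      simp at hy
      rcases hy with hy | rfl
      · exfalso
        simp only [hB', Set.mem_union, Set.mem_singleton_iff, Set.mem_ofPred_eq] at hyB
        rcases hyB with ((h | h) | h) | h
        · have h1 := hP.onlyB y (hp1P y hy) h
          subst h1
          have : y ∈ x :: p2 := hp2.last_mem
          rw [List.nodup_append] at hPnd
          exact hPnd.2.2 y hy y this rfl
        · subst h
          rw [List.nodup_append] at hPnd
          exact hPnd.2.2 y hy y (by simp) rfl
        · rw [List.nodup_append] at hPnd
          exact hPnd.2.2 y hy y (by simp [h]) rfl
        · exact hr2P y h (hp1P y hy)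
      · rfl
  have hyp' : ∀ v, ∃ u ∈ A, ∃ w ∈ B', ∃ l, LP G u w l ∧ v ∉ l := by
    intro v
    obtain ⟨u, hu, w, hw, h⟩ := hyp v
    exact ⟨u, hu, w, hBB hw, h⟩
  have key : ∀ (c1 c2 y : V) (Qx Qy : List V), ABP G A B' c1 x Qx → ABP G A B' c2 y Qy →
      (∀ z ∈ Qx, z ∉ Qy) → ∃ d1 d2 Q1 Q2, ABP G A B c1 d1 Q1 ∧ ABP G A B c2 d2 Q2 ∧
        (∀ z ∈ Q1, z ∉ Q2) ∧ (b = d1 ∨ b = d2) := by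
    intro c1 c2 y Qx Qy hQx hQy hd
    have hPB : ∀ z ∈ x :: p2, z ∈ B → z = b := by
      intro z hz hzB
      apply hP.onlyB z _ hzB
      rcases List.mem_cons.1 hz with rfl | hz
      · exact hxP
      · exact hp2P z hz
    have hRB : ∀ z ∈ x :: r2, z ∈ B → z = s := by
      intro z hz hzB
      apply hR.onlyB z _ hzB
      rcases List.mem_cons.1 hz with rfl | hz
      · exact hxR
      · exact hr2R z hz
    have hyx : y ≠ x := by
      rintro rfl
      exact hd y hQx.lp.last_mem hQy.lp.last_mem
    have E1 : ABP G A B c1 b (Qx ++ p2) :=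
      hQx.extend hp2 hp2B' hBB hP.hb hp2A hPB
    have E2 : ABP G A B c1 s (Qx ++ r2) :=
      hQx.extend hr2 hr2B' hBB hR.hb hr2A hRB
    have hQxB : ∀ z ∈ Qx, z ∈ B' → z = x := hQx.onlyB
    have hQyB : ∀ z ∈ Qy, z ∈ B' → z = y := hQy.onlyB
    have hxQy : x ∉ Qy := hd x hQx.lp.last_mem
    by_cases hyp2 : y ∈ p2
    · obtain ⟨q1, q2, e, -, hq2⟩ := hp2.split (x := y) (by simp [hyp2])
      have hq1 : ∃ q1', q1 = x :: q1' := by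
        cases q1 with
        | nil => simp at e; exact absurd e.1.symm hyx
        | cons c q1 => simp at e; exact ⟨q1, by rw [e.1]⟩
      obtain ⟨q1', rfl⟩ := hq1
      simp at e
      have hq2p : ∀ z ∈ q2, z ∈ p2 := by intro z hz; rw [e]; simp [hz]
      have hp2nd : (q1' ++ y :: q2).Nodup := by
        rw [← e]; exact (List.nodup_cons.1 hp2.nodup).2
      have E3 : ABP G A B c2 b (Qy ++ q2) := by
        refine hQy.extend hq2 (fun z hz => hp2B' z (hq2p z hz)) hBB hP.hb
          (fun z hz => hp2A z (hq2p z hz)) ?_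
        intro z hz
        apply hPB
        rcases List.mem_cons.1 hz with rfl | hz
        · simp [hyp2]
        · simp [hq2p z hz]
      refine ⟨s, b, _, _, E2, E3, ?_, Or.inr rfl⟩
      intro z hz hz'
      rcases List.mem_append.1 hz with h | h <;> rcases List.mem_append.1 hz' with h' | h'
      · exact hd z h h'
      · have := hQxB z h (hp2B' z (hq2p z h'))
        subst this
        exact (List.nodup_cons.1 hp2.nodup).1 (hq2p z h')
      · have := hQyB z h' (hr2B' z h)
        subst this
        exact hr2P z h (hp2P z hyp2)
      · exact hr2P z h (hp2P z (hq2p z h'))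
    · by_cases hyr2 : y ∈ r2
      · obtain ⟨q1, q2, e, -, hq2⟩ := hr2.split (x := y) (by simp [hyr2])
        have hq1 : ∃ q1', q1 = x :: q1' := by
          cases q1 with
          | nil => simp at e; exact absurd e.1.symm hyx
          | cons c q1 => simp at e; exact ⟨q1, by rw [e.1]⟩
        obtain ⟨q1', rfl⟩ := hq1
        simp at e
        have hq2p : ∀ z ∈ q2, z ∈ r2 := by intro z hz; rw [e]; simp [hz]
        have E3 : ABP G A B c2 s (Qy ++ q2) := by
          refine hQy.extend hq2 (fun z hz => hr2B' z (hq2p z hz)) hBB hR.hb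
            (fun z hz => hr2A z (hq2p z hz)) ?_
          intro z hz
          apply hRB
          rcases List.mem_cons.1 hz with rfl | hz
          · simp [hyr2]
          · simp [hq2p z hz]
        refine ⟨b, s, _, _, E1, E3, ?_, Or.inl rfl⟩
        intro z hz hz'
        rcases List.mem_append.1 hz with h | h <;> rcases List.mem_append.1 hz' with h' | h'
        · exact hd z h h'
        · have := hQxB z h (hr2B' z (hq2p z h'))
          subst this
          exact (List.nodup_cons.1 hr2.nodup).1 (hq2p z h')
        · have := hQyB z h' (hp2B' z h)
          subst this
          exact hyp2 h
        · exact hr2P z (hq2p z h') (hp2P z h)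
      · have hyB : y ∈ B := by
          have := hQy.hb
          simp only [hB', Set.mem_union, Set.mem_singleton_iff, Set.mem_ofPred_eq] at this
          tauto
        have E3 : ABP G A B c2 y Qy :=
          ⟨hQy.lp, hQy.ha, hyB, hQy.onlyA, fun z hz hzB => hQyB z hz (hBB hzB)⟩
        refine ⟨b, y, _, _, E1, E3, ?_, Or.inl rfl⟩
        intro z hz hz'
        rcases List.mem_append.1 hz with h | h
        · exact hd z h hz'
        · have := hQyB z hz' (hp2B' z h)
          subst this
          exact hyp2 h
  obtain ⟨a', b1, b2, Q1, Q2, hQ1, hQ2, hd, hb⟩ := ih _ hlt B' rfl a x _ hP' hyp'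
  rcases hb with rfl | rfl
  · obtain ⟨d1, d2, R1, R2, h1, h2, h3, h4⟩ := key _ _ _ _ _ hQ1 hQ2 hd
    exact ⟨a', d1, d2, R1, R2, h1, h2, h3, h4⟩
  · obtain ⟨d1, d2, R1, R2, h1, h2, h3, h4⟩ := key _ _ _ _ _ hQ2 hQ1 (fun z hz hz' => hd z hz' hz)
    exact ⟨a', d2, d1, R2, R1, h2, h1, fun z hz hz' => h3 z hz' hz, h4.symm⟩

theorem TwoConnected.avoid [Fintype V] (h : TwoConnected G) {u w v : V} (hu : u ≠ v) (hw : w ≠ v) :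
    ∃ l, LP G u w l ∧ v ∉ l := by
  obtain ⟨l, hl, h'⟩ := LP_of_induce (G := G) (S := ({v}ᶜ : Set V)) (u := u) (v := w)
    (by simpa using hu) (by simpa using hw) ((h.2.2 v).preconnected _ _)
  refine ⟨l, hl, fun hv => ?_⟩
  simpa using h' v hv

/-- two disjoint `A`-`B` paths extending the endpoints of a given one -/
theorem TwoConnected.two_paths [Fintype V] (h : TwoConnected G) {A B : Set V} {a b : V}
    {P : List V} (hP : ABP G A B a b P) (hA : A.Nontrivial) (hB : B.Nontrivial) :
    ∃ a' b1 b2 Q1 Q2, ABP G A B a b1 Q1 ∧ ABP G A B a' b2 Q2 ∧ (∀ x ∈ Q1, x ∉ Q2) ∧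
      (b = b1 ∨ b = b2) := by
  refine aug A _ B rfl a b P hP ?_
  intro v
  obtain ⟨u, hu, huv⟩ := hA.exists_ne v
  obtain ⟨w, hw, hwv⟩ := hB.exists_ne v
  obtain ⟨l, hl, hv⟩ := h.avoid huv hwv
  exact ⟨u, hu, w, hw, l, hl, hv⟩

end Menger


section PathBound

variable {V : Type*} {G : SimpleGraph V}

theorem LP.rotate {u v x : V} {D : List V} (hD : LP G u v D) (hadj : G.Adj v u) (hx : x ∈ D) :
    ∃ w D', LP G x w D' ∧ G.Adj w x ∧ (∀ z, z ∈ D' ↔ z ∈ D) ∧ D'.length = D.length := by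
  obtain ⟨l1, l2, e, h1, h2⟩ := hD.split hx
  by_cases hl : l1 = []
  · subst hl
    have : u = x := by
      have := h1.head
      simpa using this.symm
    subst this
    exact ⟨v, D, hD, hadj, by simp, rfl⟩
  · obtain ⟨l3, w, rfl⟩ : ∃ l3 w, l1 = l3 ++ [w] :=
      ⟨l1.dropLast, l1.getLast hl, (List.dropLast_append_getLast hl).symm⟩
    have h3 : LP G u x (l3 ++ w :: [x]) := by simpa using h1
    have h4 := h3.left_of_append
    have h5 : G.Adj w x := h3.right_of_append.chain.rel
    have hnd := hD.nodup
    rw [e, List.nodup_append] at hnd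
    refine ⟨w, (x :: l2) ++ (l3 ++ [w]), h2.join h4 hadj ?_, h5, ?_, ?_⟩
    · intro z hz hz'
      exact hnd.2.2 z hz' z hz rfl
    · intro z; rw [e]; simp; tauto
    · rw [e]; simp; omega

theorem ear_cycle {u v x y f g : V} {D E : List V} (hD : LP G u v D) (hadj : G.Adj v u)
    (hx : x ∈ D) (hy : y ∈ D) (hxy : x ≠ y) (hE : LP G f g E) (hxf : G.Adj x f) (hgy : G.Adj g y)
    (hdis : ∀ z ∈ E, z ∉ D) {k : ℕ} (hk : k ≤ E.length + 2) : HasCycleGE G k := by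
  obtain ⟨w, D', hD', hw, hm, hlen⟩ := hD.rotate hadj hx
  obtain ⟨e1, e2, e, h1, -⟩ := hD'.split ((hm y).2 hy)
  have he1 : 1 ≤ e1.length := by
    cases e1 with
    | nil =>
      have := h1.head
      simp at this
      exact absurd this.symm hxy
    | cons c e1 => simp
  have hE0 : 1 ≤ E.length := List.length_pos_iff.2 hE.ne_nil
  refine (h1.join hE.rev hgy.symm ?_).hasCycle hxf.symm ?_ ?_
  · intro z hz hz'
    apply hdis z (by simpa using hz')
    rw [← hm, e]
    simp at hz ⊢
    tauto
  · simp; omega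
  · simp; omega

theorem gap_bound [DecidableEq V] {u v : V} {D : List V} (hD : LP G u v D) (hadj : G.Adj v u) {k : ℕ}
    (hk : 1 ≤ k) (hc : ¬ HasCycleGE G k) : ∀ (n : ℕ) (a b : V) (P : List V), P.length = n →
      LP G a b P → a ∈ D → b ∈ D → P.length ≤ k * (P.filter (· ∈ D)).length := by
  intro n
  induction n using Nat.strong_induction_on with
  | _ n ih =>
  intro a b P hn hP ha hb
  obtain ⟨R, rfl⟩ := hP.eq_cons
  cases R with
  | nil => simp [ha]; omega
  | cons c R =>
    obtain ⟨h1, h2, h3⟩ := hP.tail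
    obtain ⟨E, y, hy, hE, hED, R2, e⟩ := h1.firstHit {z | z ∈ D} ⟨b, h1.last_mem, hb⟩
    simp only [Set.mem_ofPred_eq] at hy hED
    have h4 : LP G y b (y :: R2) := by
      have := h1
      rw [e] at this
      exact this.right_of_append
    rw [e] at hn ⊢
    have hr := ih _ (by simp at hn ⊢; omega) y b (y :: R2) rfl h4 hy hb
    have hay : a ≠ y := by
      rintro rfl
      apply h3
      rw [e]; simp
    have hElen : E.length + 1 ≤ k := by
      by_contra hcon
      push Not at hcon
      have hE0 : E ≠ [] := by
        rintro rfl
        simp at hcon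
        omega
      obtain ⟨E', g, rfl⟩ : ∃ l3 w, E = l3 ++ [w] :=
        ⟨E.dropLast, E.getLast hE0, (List.dropLast_append_getLast hE0).symm⟩
      have h5 : LP G c y (E' ++ g :: [y]) := by simpa using hE
      have h6 := h5.left_of_append
      have h7 : G.Adj g y := h5.right_of_append.chain.rel
      exact hc (ear_cycle hD hadj ha hy hay h6 h2 h7 hED (by omega))
    have e2 : ((a :: (E ++ y :: R2)).filter (· ∈ D)).length
        = 1 + ((y :: R2).filter (· ∈ D)).length := by
      rw [List.filter_cons, List.filter_append]
      have : E.filter (· ∈ D) = [] := by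
        rw [List.filter_eq_nil_iff]
        simpa using hED
      rw [this]
      simp [ha]; omega
    rw [e2]
    have e3 : (a :: (E ++ y :: R2)).length = 1 + E.length + (y :: R2).length := by
      simp; omega
    rw [e3, mul_add]
    omega

theorem TwoConnected.path_bound [Fintype V] (h : TwoConnected G) {k : ℕ} (hk : 3 ≤ k)
    (hc : ¬ HasCycleGE G k) {u v : V} {l : List V} (hl : LP G u v l) : l.length ≤ k * k + 3 := by
  classical
  by_contra hcon
  push Not at hcon
  have hkk : 3 ≤ k * k := by nlinarith
  obtain ⟨l0, rfl⟩ := hl.eq_cons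
  cases l0 with
  | nil => simp at hcon
  | cons a l0 =>
  obtain ⟨h1, h2, h3⟩ := hl.tail
  obtain ⟨P, e⟩ := h1.eq_concat
  have hPlen : k * k + 1 ≤ P.length := by
    have := congrArg List.length e
    simp at this hcon
    omega
  have hP0 : P ≠ [] := by rintro rfl; simp at hPlen
  obtain ⟨P', b, rfl⟩ : ∃ l3 w, P = l3 ++ [w] :=
    ⟨P.dropLast, P.getLast hP0, (List.dropLast_append_getLast hP0).symm⟩
  rw [e] at h1 h3
  have h5 : LP G a v (P' ++ b :: [v]) := by simpa using h1
  have hP := h5.left_of_append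
  have hbv : G.Adj b v := h5.right_of_append.chain.rel
  have hnd := h5.nodup
  have hvP : v ∉ P' ++ [b] := by
    have := h1.nodup
    rw [List.nodup_append] at this
    intro hv
    exact this.2.2 v hv v (by simp) rfl
  have huP : u ∉ P' ++ [b] := by
    intro hv
    exact h3 (by simp at hv ⊢; tauto)
  have huv : u ≠ v := by
    rintro rfl
    exact h3 (by simp)
  have haP := hP.head_mem
  have hbP := hP.last_mem
  have hab : a ≠ b := by
    rintro rfl
    obtain ⟨R, eR⟩ := hP.eq_cons
    cases P' with
    | nil => simp at hPlen; omega
    | cons c P' =>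
      simp at eR
      have := hP.nodup
      simp at this
      have := this.1.2
      simp_all
  have hAB : ABP G {u, a} {v, b} a b (P' ++ [b]) := by
    refine ⟨hP, by simp, by simp, ?_, ?_⟩
    · rintro x hx (rfl | rfl)
      · exact absurd hx huP
      · rfl
    · rintro x hx (rfl | rfl)
      · exact absurd hx hvP
      · rfl
  have hua : u ≠ a := by rintro rfl; exact huP haP
  have hvb : v ≠ b := by rintro rfl; exact hvP hbP
  have hub : u ≠ b := by rintro rfl; exact huP hbP
  have hva : v ≠ a := by rintro rfl; exact hvP haP
  obtain ⟨a', b1, b2, Q1, Q2, hQ1, hQ2, hd, hb⟩ := h.two_paths hAB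
    ⟨u, by simp, a, by simp, hua⟩ ⟨v, by simp, b, by simp, hvb⟩
  have ha' : a' = u := by
    rcases hQ2.ha with h | h
    · exact h
    · rw [Set.mem_singleton_iff] at h
      subst h
      exact absurd hQ2.lp.head_mem (hd _ hQ1.lp.head_mem)
  subst ha'
  have hb12 : b1 ≠ b2 := by
    rintro rfl
    exact hd _ hQ1.lp.last_mem hQ2.lp.last_mem
  have hadj12 : G.Adj b1 b2 := by
    have i1 := hQ1.hb
    have i2 := hQ2.hb
    simp only [Set.mem_insert_iff, Set.mem_singleton_iff] at i1 i2
    rcases i1 with rfl | rfl <;> rcases i2 with rfl | rfl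
    · exact absurd rfl hb12
    · exact hbv.symm
    · exact hbv
    · exact absurd rfl hb12
  have hD : LP G a a' (Q1 ++ Q2.reverse) :=
    hQ1.lp.join hQ2.lp.rev hadj12 (by simpa using hd)
  have hlen : 3 ≤ (Q1 ++ Q2.reverse).length := by
    obtain ⟨R1, r1⟩ := hQ1.lp.eq_cons
    obtain ⟨R2, r2⟩ := hQ2.lp.eq_cons
    have : R1 ≠ [] := by
      rintro rfl
      have h1 := hQ1.lp.last
      rw [r1] at h1
      simp at h1
      have := hQ1.hb
      rw [← h1] at this
      simp at this
      tauto
    have := List.length_pos_iff.2 this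
    simp [r1, r2]; omega
  have hDk : (Q1 ++ Q2.reverse).length < k := by
    by_contra hge
    exact hc (hD.hasCycle h2 hlen (by omega))
  have := gap_bound hD h2 (by omega) hc _ a b _ rfl hP hD.head_mem (by
    rcases hb with rfl | rfl
    · simp [hQ1.lp.last_mem]
    · simp [hQ2.lp.last_mem])
  have hcount : ((P' ++ [b]).filter (· ∈ Q1 ++ Q2.reverse)).length ≤ (Q1 ++ Q2.reverse).length := by
    apply List.Subperm.length_le
    apply List.subperm_of_subset
    · exact hP.nodup.filter _
    · intro x hx
      simpa using (List.mem_filter.1 hx).2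
  have : (P' ++ [b]).length ≤ k * k := this.trans (Nat.mul_le_mul_left _ (by omega))
  omega

end PathBound


section Kop

variable {V : Type*} {G : SimpleGraph V}

theorem left_lemma {h z x : V} {l : List V} (hl : LP G h z l) (hz : G.Adj h z) (hx : x ∈ l)
    (hxz : x ≠ z) : ∃ q, LP G z x q ∧ (∀ v ∈ q, v ∈ l) ∧ h ∈ q ∧ (∀ v ∈ l, G.Adj h v → v ∈ q) := by
  obtain ⟨l1, l2, e, h1, h2⟩ := hl.split hx
  cases l2 with
  | nil =>
    have := h2.last
    simp at this
    exact absurd this hxz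
  | cons c l2 =>
    obtain ⟨h3, -, h4⟩ := h2.tail
    obtain ⟨l3, g, hg, h5, h6, l4, e4⟩ := h3.firstHit {v | G.Adj h v} ⟨z, h3.last_mem, hz⟩
    simp only [Set.mem_ofPred_eq] at hg h6
    rw [e4] at h3 e
    have h7 := h3.right_of_append
    have hnd := hl.nodup
    rw [e] at hnd
    refine ⟨(g :: l4).reverse ++ (l1 ++ [x]), h7.rev.join h1 hg.symm ?_, ?_, ?_, ?_⟩
    · intro v hv hv'
      have e9 : l1 ++ x :: (l3 ++ g :: l4) = (l1 ++ [x]) ++ (l3 ++ g :: l4) := by simp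
      rw [e9, List.nodup_append] at hnd
      exact hnd.2.2 v hv' v (by simp at hv ⊢; tauto) rfl
    · intro v hv
      rw [e]; simp at hv ⊢; tauto
    · have := h1.head_mem
      simp at this ⊢; tauto
    · intro v hv hadj
      have := h6 v
      rw [e] at hv
      simp at hv ⊢; tauto

theorem close_cycle {A B : Set V} (hAB : Disjoint A B) {a a' b1 b2 : V} {Q1 Q2 L R : List V}
    (hQ1 : ABP G A B a b1 Q1) (hQ2 : ABP G A B a' b2 Q2) (hd : ∀ x ∈ Q1, x ∉ Q2)
    (hL : LP G a' a L) (hLA : ∀ v ∈ L, v ∈ A) (hR : LP G b1 b2 R) (hRB : ∀ v ∈ R, v ∈ B)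
    {k : ℕ} (h3 : 3 ≤ L.length + R.length) (hk : k ≤ L.length + R.length) : HasCycleGE G k := by
  rw [Set.disjoint_left] at hAB
  obtain ⟨Q1', e1⟩ := hQ1.lp.eq_cons
  obtain ⟨Q2', e2⟩ := hQ2.lp.eq_cons
  obtain ⟨R', eR⟩ := hR.eq_cons
  have n1 := hQ1.lp.nodup
  have n2 := hQ2.lp.nodup
  have nR := hR.nodup
  have l1 : 1 ≤ Q1'.length := by
    cases Q1' with
    | nil =>
      have := hQ1.lp.last
      rw [e1] at this
      simp at this
      subst this
      exact absurd hQ1.hb (hAB hQ1.ha)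
    | cons => simp
  cases Q2' with
  | nil =>
    have := hQ2.lp.last
    rw [e2] at this
    simp at this
    subst this
    exact absurd hQ2.hb (hAB hQ2.ha)
  | cons w Q2' =>
  have hq1 := hQ1.lp
  have hq2 := hQ2.lp
  have hR0 := hR
  rw [e1] at hq1 n1
  rw [e2] at hq2 n2
  rw [eR] at hR0 nR
  obtain ⟨hT, hw, -⟩ := hq2.tail
  have hTr := hT.rev
  obtain ⟨M, eM⟩ := hTr.eq_cons
  rw [eM] at hTr
  have nM := hTr.nodup
  have memM : ∀ v ∈ M, v ∈ w :: Q2' := by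
    intro v hv
    have : v ∈ (w :: Q2').reverse := by rw [eM]; simp [hv]
    exact List.mem_reverse.1 this
  have lM : M.length = Q2'.length := by
    have := congrArg List.length eM
    simpa using this.symm
  have s1 : LP G a' b1 (L ++ Q1') := by
    refine hL.trans' hq1 ?_
    intro v hv hvL
    have := hQ1.onlyA v (by rw [e1]; simp [hv]) (hLA v hvL)
    subst this
    simp at n1
    exact n1.1 hv
  have s2 : LP G a' b2 ((L ++ Q1') ++ R') := by
    refine s1.trans' hR0 ?_
    intro v hv hvL
    have hvB := hRB v (by rw [eR]; simp [hv])
    rw [List.mem_append] at hvL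
    rcases hvL with hvL | hvL
    · exact hAB (hLA v hvL) hvB
    · have := hQ1.onlyB v (by rw [e1]; simp [hvL]) hvB
      subst this
      simp at nR
      exact nR.1 hv
  have s3 : LP G a' w (((L ++ Q1') ++ R') ++ M) := by
    refine s2.trans' hTr ?_
    intro v hv hvL
    have hv2 : v ∈ Q2 := by rw [e2]; exact List.mem_cons_of_mem _ (memM v hv)
    simp only [List.mem_append] at hvL
    rcases hvL with (hvL | hvL) | hvL
    · have := hQ2.onlyA v hv2 (hLA v hvL)
      subst this
      have := memM v hv
      simp at n2 this
      tauto
    · exact hd v (by rw [e1]; simp [hvL]) hv2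
    · have := hQ2.onlyB v hv2 (hRB v (by rw [eR]; simp [hvL]))
      subst this
      simp at nM
      exact nM.1 hv
  refine s3.hasCycle hw.symm ?_ ?_
  · rw [eR] at h3
    simp at h3 ⊢; omega
  · rw [eR] at hk
    simp at hk ⊢; omega

theorem LP.split_at {u v : V} {l : List V} (hl : LP G u v l) {i : ℕ} (hi : i < l.length) :
    LP G u (l.getD i u) (l.take (i+1)) ∧ LP G (l.getD i u) v (l.drop i) := by
  have e : l = l.take i ++ l[i] :: l.drop (i+1) := by
    rw [← List.drop_eq_getElem_cons, List.take_append_drop]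
  have e1 : l.getD i u = l[i] := by simp [hi]
  rw [e1]
  constructor
  · rw [List.take_add_one, List.getElem?_eq_getElem hi]
    rw [e] at hl
    simpa using hl.left_of_append
  · rw [List.drop_eq_getElem_cons hi]
    rw [e] at hl
    simpa using hl.right_of_append

theorem kop_cross {x y : V} {l : List V} {t : ℕ} (hl : LP G x y l)
    (hlen : 2 * t + 2 ≤ l.length) (ht : 1 ≤ t) (I J : Finset ℕ)
    (hI : ∀ i, i ∈ I ↔ i < l.length ∧ G.Adj x (l.getD i x))
    (hJ : ∀ i, i ∈ J ↔ i < l.length ∧ G.Adj y (l.getD i x))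
    (hIc : t + 1 ≤ I.card) (hJc : t + 1 ≤ J.card)
    (hcr : ∃ d i, i ∈ J ∧ i + d + 1 ∈ I) : HasCycleGE G (2 * t + 2) := by
  classical
  let d := Nat.find hcr
  obtain ⟨i, hi, hj⟩ : ∃ i, i ∈ J ∧ i + d + 1 ∈ I := Nat.find_spec hcr
  have hmin : ∀ i j, i ∈ J → j ∈ I → i < j → i + d + 1 ≤ j := by
    intro i' j' hi' hj' hlt
    have h1 : d ≤ j' - i' - 1 := Nat.find_min' hcr ⟨i', hi', by
      have : i' + (j' - i' - 1) + 1 = j' := by omega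
      rw [this]; exact hj'⟩
    omega
  obtain ⟨hi1, hi2⟩ := (hI _).1 hj
  obtain ⟨hj1, hj2⟩ := (hJ _).1 hi
  have a1 := (hl.split_at hj1).1
  have a2 := (hl.split_at hi1).2
  have hy : l.getD (l.length - 1) x = y := by
    have := hl.last
    rw [List.getLast?_eq_getElem?] at this
    simp [this]
  have hx : l.getD 0 x = x := by
    have := hl.head
    rw [List.head?_eq_getElem?] at this
    simp [this]
  have hc : LP G x (l.getD (i+d+1) x) (l.take (i+1) ++ (l.drop (i+d+1)).reverse) := by
    refine a1.join a2.rev hj2.symm ?_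
    intro v hv hv'
    have hv' : v ∈ l.drop (i+d+1) := by simpa using hv'
    have := List.disjoint_take_drop hl.nodup (show i + 1 ≤ i + d + 1 by omega)
    exact this hv hv'
  have key : 2 * t + 2 ≤ (l.take (i+1) ++ (l.drop (i+d+1)).reverse).length := by
    have e : (l.take (i+1) ++ (l.drop (i+d+1)).reverse).length = i + 1 + (l.length - (i+d+1)) := by
      simp; omega
    rw [e]
    by_cases hd : d = 0
    · omega
    · have hI0 : ∀ p ∈ I, 1 ≤ p := by
        intro p hp
        rcases Nat.eq_zero_or_pos p with rfl | h
        · have := ((hI _).1 hp).2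
          rw [hx] at this
          exact absurd this (G.loopless.irrefl _)
        · exact h
      have hJm : ∀ p ∈ J, p ≠ l.length - 1 := by
        rintro p hp rfl
        have := ((hJ _).1 hp).2
        rw [hy] at this
        exact absurd this (G.loopless.irrefl _)
      let I' := (I.erase (i+d+1)).image (fun p => p - 1)
      have cI' : t ≤ I'.card := by
        rw [Finset.card_image_of_injOn]
        · rw [Finset.card_erase_of_mem hj]; omega
        · intro p hp q hq hpq
          have h1 := hI0 p (Finset.mem_of_mem_erase hp)
          have h2 := hI0 q (Finset.mem_of_mem_erase hq)
          simp only at hpq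
          omega
      have hdis : Disjoint I' J := by
        rw [Finset.disjoint_left]
        intro p hp hpJ
        obtain ⟨q, hq, rfl⟩ := Finset.mem_image.1 hp
        have hq' := Finset.mem_of_mem_erase hq
        have := hI0 q hq'
        have := hmin _ _ hpJ hq' (by omega)
        omega
      have hU : insert (l.length - 1) (I' ∪ J) ⊆ Finset.range (i+1) ∪ Finset.Ico (i+d+1) l.length := by
        intro p hp
        rw [Finset.mem_insert, Finset.mem_union] at hp
        rw [Finset.mem_union, Finset.mem_range, Finset.mem_Ico]
        rcases hp with rfl | hp | hp
        · omega
        · obtain ⟨q, hq, rfl⟩ := Finset.mem_image.1 hp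
          have hq' := Finset.mem_of_mem_erase hq
          have hne := Finset.ne_of_mem_erase hq
          have h0 := hI0 q hq'
          have h1 := ((hI _).1 hq').1
          have h2 := hmin i q hi hq'
          omega
        · have h1 := ((hJ _).1 hp).1
          have h2 := hmin p (i+d+1) hp hj
          omega
      have hcard := Finset.card_le_card hU
      rw [Finset.card_insert_of_notMem, Finset.card_union_of_disjoint hdis] at hcard
      · have := Finset.card_union_le (Finset.range (i+1)) (Finset.Ico (i+d+1) l.length)
        rw [Finset.card_range, Nat.card_Ico] at this
        omega
      · rw [Finset.mem_union]
        rintro (hp | hp)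
        · obtain ⟨q, hq, he⟩ := Finset.mem_image.1 hp
          have hq' := Finset.mem_of_mem_erase hq
          have h1 := ((hI _).1 hq').1
          have h0 := hI0 q hq'
          omega
        · exact hJm _ hp rfl
  exact hc.hasCycle hi2.symm (by omega) key

theorem kop_noncross [Fintype V] (h2 : TwoConnected G) {x y : V} {l : List V} {t : ℕ}
    (hl : LP G x y l) (ht : 1 ≤ t) (I J : Finset ℕ)
    (hI : ∀ i, i ∈ I ↔ i < l.length ∧ G.Adj x (l.getD i x))
    (hJ : ∀ i, i ∈ J ↔ i < l.length ∧ G.Adj y (l.getD i x))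
    (hIc : t + 1 ≤ I.card) (hJc : t + 1 ≤ J.card)
    (hcr : ∀ i ∈ J, ∀ j ∈ I, j ≤ i) : HasCycleGE G (2 * t + 2) := by
  classical
  have hIne : I.Nonempty := Finset.card_pos.1 (by omega)
  set i := I.max' hIne with hi
  have hiI : i ∈ I := I.max'_mem _
  have hJ'c : t ≤ (J.erase i).card := by
    have := Finset.pred_card_le_card_erase (s := J) (a := i); omega
  have hJne : (J.erase i).Nonempty := Finset.card_pos.1 (by omega)
  set j := (J.erase i).min' hJne with hj
  have hjJ : j ∈ J.erase i := Finset.min'_mem _ _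
  have hij : i < j := by
    have h1 := hcr j (Finset.mem_of_mem_erase hjJ) i hiI
    have h2 := Finset.ne_of_mem_erase hjJ
    omega
  obtain ⟨hi1, hi2⟩ := (hI _).1 hiI
  obtain ⟨hj1, hj2⟩ := (hJ _).1 (Finset.mem_of_mem_erase hjJ)
  set a := l.getD i x with ha
  set b := l.getD j x with hb
  have LA := (hl.split_at hi1).1
  have LB := (hl.split_at hj1).2
  rw [← ha] at LA
  rw [← hb] at LB
  set A : Set V := {v | v ∈ l.take (i+1)} with hA
  set B : Set V := {v | v ∈ l.drop j} with hB
  have hAB : Disjoint A B := by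
    rw [Set.disjoint_left]
    intro v hv hv'
    exact List.disjoint_take_drop hl.nodup (show i + 1 ≤ j by omega) hv hv'
  have hmid : ∃ a0 b0 P, ABP G A B a0 b0 P ∧ a0 = a ∧ b0 = b := by
    have hM : LP G a y (l.drop i) := (hl.split_at hi1).2
    have hbl : b ∈ l.drop i := by
      have : l.drop j = (l.drop i).drop (j - i) := by
        rw [List.drop_drop]; congr 1; omega
      have h3 := LB.head_mem
      rw [this] at h3
      exact List.mem_of_mem_drop h3
    obtain ⟨P, x0, hx0, h3, h4, P2, e⟩ := hM.firstHit B ⟨b, hbl, LB.head_mem⟩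
    have htail : ∀ v ∈ l.drop i, v ∈ A → v = a := by
      intro v hv hvA
      rw [List.drop_eq_getElem_cons hi1] at hv
      rcases List.mem_cons.1 hv with hv | hv
      · rw [hv, ha]; simp [hi1]
      · exact absurd hv (List.disjoint_take_drop hl.nodup le_rfl hvA)
    have hx0b : x0 = b := by
      have e2 : l.drop i = (l.drop i).take (j - i) ++ l.drop j := by
        have : l.drop j = (l.drop i).drop (j - i) := by
          rw [List.drop_drop]; congr 1; omega
        rw [this, List.take_append_drop]
      obtain ⟨B', eB⟩ := LB.eq_cons
      rw [eB] at e2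
      have nd := hM.nodup
      by_contra hne
      have hbP : b ∉ P := fun h => h4 b h LB.head_mem
      have hx0' : x0 ∈ B' := by
        have : x0 ∈ l.drop j := hx0
        rw [eB] at this
        rcases List.mem_cons.1 this with h | h
        · exact absurd h hne
        · exact h
      obtain ⟨B1, B2, rfl⟩ := List.append_of_mem hx0'
      have e3 : P ++ x0 :: P2 = ((l.drop i).take (j - i) ++ b :: B1) ++ x0 :: B2 := by
        rw [← e]; refine e2.trans ?_; simp
      have hP : P = (l.drop i).take (j - i) ++ b :: B1 := by
        have nd1 : (P ++ x0 :: P2).Nodup := e ▸ nd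
        have nd2 : (((l.drop i).take (j - i) ++ b :: B1) ++ x0 :: B2).Nodup := e3 ▸ nd1
        rw [List.append_eq_append_iff] at e3
        rcases e3 with ⟨c, h5, h6⟩ | ⟨c, h5, h6⟩
        · cases c with
          | nil => simpa using h5.symm
          | cons d c =>
            simp at h6
            exfalso
            rw [h5] at nd2
            rw [List.nodup_append] at nd2
            exact nd2.2.2 x0 (by simp [h6.1]) x0 (by simp) rfl
        · cases c with
          | nil => simpa using h5
          | cons d c =>
            simp at h6
            exfalso
            rw [h5] at nd1
            rw [List.nodup_append] at nd1
            exact nd1.2.2 x0 (by simp [h6.1]) x0 (by simp) rfl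
      apply hbP
      rw [hP]; simp
    refine ⟨a, x0, P ++ [x0], ⟨h3, LA.last_mem, hx0, ?_, ?_⟩, rfl, hx0b⟩
    · intro v hv hvA
      apply htail v _ hvA
      rw [e]; simp at hv ⊢; tauto
    · intro v hv hvB
      have := h4 v
      simp at hv
      tauto
  obtain ⟨a0, b0, P, hP, rfl, rfl⟩ := hmid
  have hxA : x ∈ A := LA.head_mem
  have hyB : y ∈ B := LB.last_mem
  obtain ⟨a', b1, b2, Q1, Q2, hQ1, hQ2, hd, hbb⟩ := h2.two_paths hP
    ⟨x, hxA, _, LA.last_mem, hi2.ne⟩ ⟨y, hyB, _, LB.head_mem, hj2.ne⟩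
  have haa : a' ≠ a := by
    intro h
    exact hd _ hQ1.lp.head_mem (h ▸ hQ2.lp.head_mem)
  have hb12 : b1 ≠ b2 := by
    rintro rfl
    exact hd _ hQ1.lp.last_mem hQ2.lp.last_mem
  obtain ⟨L, hL, hLA, hxL, hNL⟩ := left_lemma LA hi2 hQ2.ha haa
  have hright : ∃ R, LP G b1 b2 R ∧ (∀ v ∈ R, v ∈ B) ∧ y ∈ R ∧ (∀ v ∈ B, G.Adj y v → v ∈ R) := by
    have LBr := LB.rev
    rcases hbb with h | h
    · obtain ⟨R, r1, r2, r3, r4⟩ := left_lemma (x := b2) LBr hj2 (List.mem_reverse.2 hQ2.hb)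
        (by rw [h]; exact hb12.symm)
      refine ⟨R, ?_, ?_, r3, ?_⟩
      · rwa [h] at r1
      · intro v hv; simpa [hB] using r2 v hv
      · intro v hv; exact r4 v (by simpa [hB] using hv)
    · obtain ⟨R, r1, r2, r3, r4⟩ := left_lemma (x := b1) LBr hj2 (List.mem_reverse.2 hQ1.hb)
        (by rw [h]; exact hb12)
      refine ⟨R.reverse, ?_, ?_, by simpa using r3, ?_⟩
      · rw [h] at r1; exact r1.rev
      · intro v hv; simpa [hB] using r2 v (by simpa using hv)
      · intro v hv hadj
        simpa using r4 v (by simpa [hB] using hv) hadj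
  obtain ⟨R, hR, hRB, hyR, hNR⟩ := hright
  have hinj : ∀ p < l.length, ∀ q < l.length, l.getD p x = l.getD q x → p = q := by
    intro p hp q hq hpq
    simp only [List.getD_eq_getElem?_getD, List.getElem?_eq_getElem hp, List.getElem?_eq_getElem hq,
      Option.getD_some] at hpq
    exact (hl.nodup.getElem_inj_iff).1 hpq
  have lenL : t + 2 ≤ L.length := by
    have hsub : insert x (I.image (fun p => l.getD p x)) ⊆ L.toFinset := by
      intro v hv
      rw [List.mem_toFinset]
      rcases Finset.mem_insert.1 hv with rfl | hv
      · exact hxL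
      · obtain ⟨p, hp, rfl⟩ := Finset.mem_image.1 hv
        obtain ⟨p1, p2⟩ := (hI _).1 hp
        apply hNL _ _ p2
        have : p ≤ i := Finset.le_max' _ _ hp
        have e : l.getD p x = l[p] := by simp [p1]
        simp only [e]
        exact List.mem_take_iff_getElem.2 ⟨p, by omega, rfl⟩
    have h5 := Finset.card_le_card hsub
    rw [Finset.card_insert_of_notMem, Finset.card_image_of_injOn] at h5
    · have := List.toFinset_card_le L
      omega
    · intro p hp q hq
      exact hinj p ((hI _).1 hp).1 q ((hI _).1 hq).1
    · intro hv
      obtain ⟨p, hp, hpx⟩ := Finset.mem_image.1 hv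
      have := ((hI _).1 hp).2
      rw [hpx] at this
      exact G.loopless.irrefl _ this
  have lenR : t + 1 ≤ R.length := by
    have hsub : insert y ((J.erase i).image (fun p => l.getD p x)) ⊆ R.toFinset := by
      intro v hv
      rw [List.mem_toFinset]
      rcases Finset.mem_insert.1 hv with rfl | hv
      · exact hyR
      · obtain ⟨p, hp, rfl⟩ := Finset.mem_image.1 hv
        obtain ⟨p1, p2⟩ := (hJ _).1 (Finset.mem_of_mem_erase hp)
        apply hNR _ _ p2
        have : j ≤ p := Finset.min'_le _ _ hp
        have e : l.getD p x = l[p] := by simp [p1]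
        simp only [e]
        exact List.mem_drop_iff_getElem.2 ⟨p - j, by omega, by congr 1; omega⟩
    have h5 := Finset.card_le_card hsub
    rw [Finset.card_insert_of_notMem, Finset.card_image_of_injOn] at h5
    · have := List.toFinset_card_le R
      omega
    · intro p hp q hq
      exact hinj p ((hJ _).1 (Finset.mem_of_mem_erase hp)).1 q
        ((hJ _).1 (Finset.mem_of_mem_erase hq)).1
    · intro hv
      obtain ⟨p, hp, hpx⟩ := Finset.mem_image.1 hv
      have := ((hJ _).1 (Finset.mem_of_mem_erase hp)).2
      rw [hpx] at this
      exact G.loopless.irrefl _ this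
  exact close_cycle hAB hQ1 hQ2 hd hL.rev (by intro v hv; exact hLA v (by simpa using hv)) hR hRB
    (by simp; omega) (by simp; omega)

theorem kopylov [Fintype V] (h2 : TwoConnected G) {x y : V} {l : List V} {t : ℕ}
    (hl : LP G x y l) (ht : 1 ≤ t) (hlen : 2 * t + 2 ≤ l.length) (S T : Finset V)
    (hS : ∀ v ∈ S, v ∈ l ∧ G.Adj x v) (hT : ∀ v ∈ T, v ∈ l ∧ G.Adj y v)
    (hSc : t + 1 ≤ S.card) (hTc : t + 1 ≤ T.card) : HasCycleGE G (2 * t + 2) := by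
  classical
  let I := (Finset.range l.length).filter (fun i => G.Adj x (l.getD i x))
  let J := (Finset.range l.length).filter (fun i => G.Adj y (l.getD i x))
  have hI : ∀ i, i ∈ I ↔ i < l.length ∧ G.Adj x (l.getD i x) := by intro i; simp [I]
  have hJ : ∀ i, i ∈ J ↔ i < l.length ∧ G.Adj y (l.getD i x) := by intro i; simp [J]
  have hIc : t + 1 ≤ I.card := by
    have : S ⊆ I.image (fun p => l.getD p x) := by
      intro v hv
      obtain ⟨h1, h2⟩ := hS v hv
      obtain ⟨i, hi, rfl⟩ := List.mem_iff_getElem.1 h1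
      refine Finset.mem_image.2 ⟨i, (hI i).2 ⟨hi, ?_⟩, ?_⟩ <;> simp [hi, h2]
    exact hSc.trans ((Finset.card_le_card this).trans Finset.card_image_le)
  have hJc : t + 1 ≤ J.card := by
    have : T ⊆ J.image (fun p => l.getD p x) := by
      intro v hv
      obtain ⟨h1, h2⟩ := hT v hv
      obtain ⟨i, hi, rfl⟩ := List.mem_iff_getElem.1 h1
      refine Finset.mem_image.2 ⟨i, (hJ i).2 ⟨hi, ?_⟩, ?_⟩ <;> simp [hi, h2]
    exact hTc.trans ((Finset.card_le_card this).trans Finset.card_image_le)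
  by_cases hcr : ∃ d i, i ∈ J ∧ i + d + 1 ∈ I
  · exact kop_cross hl hlen ht I J hI hJ hIc hJc hcr
  · push Not at hcr
    refine kop_noncross h2 hl ht I J hI hJ hIc hJc ?_
    intro i hi j hj
    by_contra hlt
    push Not at hlt
    apply hcr (j - i - 1) i hi
    have : i + (j - i - 1) + 1 = j := by omega
    rwa [this]

end Kop


section Sat

variable {V : Type*} {G H : SimpleGraph V}

theorem LP.mono {u v : V} {l : List V} (h : LP G u v l) (hle : G ≤ H) : LP H u v l :=
  ⟨h.chain.imp (fun _ _ hab => hle hab), h.nodup, h.head, h.last⟩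

theorem TwoConnected.mono [Fintype V] (h : TwoConnected G) (hle : G ≤ H) : TwoConnected H := by
  refine ⟨h.1, h.2.1.mono hle, fun v => (h.2.2 v).mono ?_⟩
  intro a b hab
  exact hle hab

theorem degOn_mono_set [Finite V] {S T : Set V} (hST : S ⊆ T) (v : V) :
    degOn G S v ≤ degOn G T v := by
  apply Set.ncard_le_ncard _ (Set.toFinite _)
  intro x hx
  exact ⟨hST hx.1, hx.2⟩

theorem degOn_mono [Finite V] (hle : G ≤ H) (S : Set V) (v : V) :
    degOn G S v ≤ degOn H S v := by
  apply Set.ncard_le_ncard _ (Set.toFinite _)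
  intro x hx
  exact ⟨hx.1, hle hx.2⟩

theorem LP.of_sup_edge {x y u v : V} {l : List V} (h : LP (H ⊔ SimpleGraph.edge x y) u v l)
    (hx : x ∉ l ∨ y ∉ l) : LP H u v l := by
  refine ⟨?_, h.nodup, h.head, h.last⟩
  have hc := h.chain
  rw [List.isChain_iff_getElem] at hc ⊢
  intro i hi
  have := hc i hi
  have m1 : l[i] ∈ l := List.getElem_mem _
  have m2 : l[i+1] ∈ l := List.getElem_mem _
  rw [SimpleGraph.sup_adj, SimpleGraph.edge_adj] at this
  rcases this with h | ⟨⟨h1, h2⟩ | ⟨h1, h2⟩, -⟩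
  · exact h
  · rw [h1] at m1; rw [h2] at m2; tauto
  · rw [h1] at m1; rw [h2] at m2; tauto

theorem adj_of_sup_edge {x y u : V} (h : (H ⊔ SimpleGraph.edge x y).Adj u x) (hu : u ≠ y) :
    H.Adj u x := by
  rw [SimpleGraph.sup_adj, SimpleGraph.edge_adj] at h
  rcases h with h | ⟨⟨h1, h2⟩ | ⟨h1, h2⟩, h3⟩
  · exact h
  · exact absurd (h1.trans h2) hu
  · exact absurd h1 hu

theorem sat_path {k : ℕ} (hk : 3 ≤ k) (hc : ¬ HasCycleGE H k)
    (hmax : ∀ H', H ≤ H' → ¬ HasCycleGE H' k → H' ≤ H) {x y : V} (hxy : x ≠ y)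
    (hnadj : ¬ H.Adj x y) : ∃ l, LP H x y l ∧ k ≤ l.length := by
  have hcyc : HasCycleGE (H ⊔ SimpleGraph.edge x y) k := by
    by_contra hcon
    have := hmax _ le_sup_left hcon
    apply hnadj
    apply this
    rw [SimpleGraph.sup_adj, SimpleGraph.edge_adj]
    right; exact ⟨Or.inl ⟨rfl, rfl⟩, hxy⟩
  obtain ⟨u, v, D, hD, hadj, h3, hkD⟩ := hcyc.exists_list
  by_cases hxD : x ∈ D
  · obtain ⟨w, D', hD', hw, hm, hlen⟩ := hD.rotate hadj hxD
    obtain ⟨D2, e⟩ := hD'.eq_cons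
    cases D2 with
    | nil => rw [e] at hlen; simp at hlen; omega
    | cons c D2 =>
      rw [e] at hD' hlen
      obtain ⟨t1, t2, t3⟩ := hD'.tail
      have s1 : LP H c w (c :: D2) := t1.of_sup_edge (Or.inl t3)
      have hcw : c ≠ w := by
        rintro rfl
        cases D2 with
        | nil => simp at hlen; omega
        | cons d D2 =>
          have h5 := s1.tail
          exact h5.2.2 h5.1.last_mem
      by_cases hcy : c = y
      · subst hcy
        have hwx := adj_of_sup_edge hw hcw.symm
        refine ⟨x :: (c :: D2).reverse, s1.rev.cons hwx.symm (fun h => t3 (List.mem_reverse.1 h)), ?_⟩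
        simp at hlen ⊢; omega
      · have hcx := adj_of_sup_edge t2.symm hcy
        by_cases hwy : w = y
        · subst hwy
          refine ⟨x :: c :: D2, s1.cons hcx.symm t3, ?_⟩
          omega
        · have hwx := adj_of_sup_edge hw hwy
          exact absurd ((s1.cons hcx.symm t3).hasCycle hwx (by omega) (by omega)) hc
  · have hD2 := hD.of_sup_edge (Or.inl hxD)
    have hvu : H.Adj v u := by
      rw [SimpleGraph.sup_adj, SimpleGraph.edge_adj] at hadj
      have m1 := hD.head_mem
      have m2 := hD.last_mem
      rcases hadj with h | ⟨⟨h1, h2⟩ | ⟨h1, h2⟩, h3⟩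
      · exact h
      · subst h1; tauto
      · subst h2; tauto
    exact absurd (hD2.hasCycle hvu h3 hkD) hc

theorem dense_clique [Fintype V] (h2 : TwoConnected H) {t : ℕ} (ht : 1 ≤ t)
    (hc : ¬ HasCycleGE H (2 * t + 2))
    (hmax : ∀ H', H ≤ H' → ¬ HasCycleGE H' (2 * t + 2) → H' ≤ H) (W : Set V)
    (hW : ∀ v ∈ W, t + 1 ≤ degOn H W v) : ∀ x ∈ W, ∀ y ∈ W, x ≠ y → H.Adj x y := by
  classical
  by_contra hcon
  push Not at hcon
  obtain ⟨x0, hx0, y0, hy0, hne0, hna0⟩ := hcon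
  obtain ⟨l0, hl0, hk0⟩ := sat_path (by omega) hc hmax hne0 hna0
  let Pr : ℕ → Prop := fun m => ∃ x ∈ W, ∃ y ∈ W, x ≠ y ∧ ¬ H.Adj x y ∧ ∃ l, LP H x y l ∧ l.length = m
  have hbd : ∀ m, Pr m → m ≤ Fintype.card V := by
    rintro m ⟨x, -, y, -, -, -, l, hl, rfl⟩
    exact hl.nodup.length_le_card
  have hP0 : Pr l0.length := ⟨x0, hx0, y0, hy0, hne0, hna0, l0, hl0, rfl⟩
  have hspec := Nat.findGreatest_spec (hbd _ hP0) hP0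
  have hge := Nat.le_findGreatest (hbd _ hP0) hP0
  set M := Nat.findGreatest Pr (Fintype.card V) with hM
  have hmx : ∀ m, Pr m → m ≤ M := fun m hm => Nat.le_findGreatest (hbd m hm) hm
  obtain ⟨x, hx, y, hy, hne, hna, l, hl, hlM⟩ := hspec
  have key : ∀ x y l, x ∈ W → y ∈ W → ¬ H.Adj x y → LP H x y l → l.length = M →
      ∀ z ∈ W, H.Adj x z → z ∈ l := by
    intro x y l hx hy hna hl hlM z hz hxz
    by_contra hzl
    have hzy : z ≠ y := by rintro rfl; exact hzl hl.last_mem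
    by_cases hadj : H.Adj z y
    · exact hc ((hl.cons hxz.symm hzl).hasCycle hadj.symm (by simp; omega) (by simp; omega))
    · have := hmx (l.length + 1) ⟨z, hz, y, hy, hzy, hadj, z :: l, hl.cons hxz.symm hzl, by simp⟩
      omega
  refine hc (kopylov h2 hl ht (by omega) (Set.toFinite {v ∈ W | H.Adj x v}).toFinset
    (Set.toFinite {v ∈ W | H.Adj y v}).toFinset ?_ ?_ ?_ ?_)
  · intro v hv
    simp only [Set.Finite.mem_toFinset] at hv
    exact ⟨key x y l hx hy hna hl hlM v hv.1 hv.2, hv.2⟩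
  · intro v hv
    simp only [Set.Finite.mem_toFinset] at hv
    have := key y x l.reverse hy hx (fun h => hna h.symm) hl.rev (by simpa using hlM) v hv.1 hv.2
    exact ⟨List.mem_reverse.1 this, hv.2⟩
  · rw [← Set.ncard_eq_toFinset_card]
    exact hW x hx
  · rw [← Set.ncard_eq_toFinset_card]
    exact hW y hy

theorem clique_cycle (W : Finset V) (hW : ∀ x ∈ W, ∀ y ∈ W, x ≠ y → H.Adj x y) {k : ℕ}
    (h3 : 3 ≤ W.card) (hk : k ≤ W.card) : HasCycleGE H k := by
  have hnd := W.nodup_toList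
  have hlen := W.length_toList
  have hmem : ∀ v, v ∈ W.toList → v ∈ W := fun v => Finset.mem_toList.1
  cases hl : W.toList with
  | nil => rw [hl] at hlen; simp at hlen; omega
  | cons a l =>
    rw [hl] at hnd hlen hmem
    have hne : a :: l ≠ [] := by simp
    have hLP : LP H a ((a :: l).getLast hne) (a :: l) := by
      refine ⟨?_, hnd, by simp, List.getLast?_eq_some_getLast hne⟩
      apply List.Pairwise.isChain
      refine List.Pairwise.imp_of_mem ?_ hnd
      intro p q hp hq hpq
      exact hW p (hmem p hp) q (hmem q hq) hpq
    refine hLP.hasCycle (hW _ (hmem _ hLP.last_mem) _ (hmem _ hLP.head_mem) ?_) (by omega) (by omega)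
    intro h
    cases l with
    | nil => simp at hlen; omega
    | cons b l =>
      obtain ⟨h1, -, h2⟩ := hLP.tail
      apply h2
      rw [← h]
      exact h1.last_mem

theorem degeneracy [Fintype V] (h2 : TwoConnected G) {t : ℕ} (ht : 1 ≤ t)
    (hc : ¬ HasCycleGE G (2 * t + 2)) : ∃ W : Set V, W.ncard ≤ 2 * t + 1 ∧
      ∀ U : Set V, U.Nonempty → Disjoint U W → ∃ v ∈ U, degOn G (U ∪ W) v ≤ t := by
  classical
  obtain ⟨H, hGH, hH⟩ := (Set.toFinite {H : SimpleGraph V | ¬ HasCycleGE H (2 * t + 2)}).exists_le_maximal hc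
  have hcH : ¬ HasCycleGE H (2 * t + 2) := hH.prop
  have hmax : ∀ H', H ≤ H' → ¬ HasCycleGE H' (2 * t + 2) → H' ≤ H := fun H' h1 h2 => hH.le_of_ge h2 h1
  let W : Set V := ⋃₀ {S | ∀ v ∈ S, t + 1 ≤ degOn H S v}
  have hW : ∀ v ∈ W, t + 1 ≤ degOn H W v := by
    rintro v ⟨S, hS, hv⟩
    exact (hS v hv).trans (degOn_mono_set (Set.subset_sUnion_of_mem hS) v)
  refine ⟨W, ?_, ?_⟩
  · by_contra hcon
    push Not at hcon
    rw [Set.ncard_eq_toFinset_card W (Set.toFinite _)] at hcon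
    have := dense_clique (h2.mono hGH) ht hcH hmax W hW
    exact hcH (clique_cycle (Set.toFinite W).toFinset (by simpa using this) (by omega) (by omega))
  · intro U hU hdis
    by_contra hcon
    push Not at hcon
    obtain ⟨u, hu⟩ := hU
    have : U ∪ W ⊆ W := by
      apply Set.subset_sUnion_of_mem
      rintro v (hv | hv)
      · exact (hcon v hv).trans_le (degOn_mono hGH _ v)
      · exact (hW v hv).trans (degOn_mono_set Set.subset_union_right v)
    exact Set.disjoint_left.1 hdis hu (this (Or.inl hu))

end Sat


section Comps

variable {V : Type*} {G : SimpleGraph V}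

theorem LP.concat {S : Set V} {u v w : V} {l m : List V} (hl : LP G u v l) (hm : LP G v w m)
    (hlS : ∀ x ∈ l, x ∈ S) (hmS : ∀ x ∈ m, x ∈ S) : ∃ n, LP G u w n ∧ ∀ x ∈ n, x ∈ S := by
  obtain ⟨l1, x, hx, h1, h2, l2, e⟩ := hl.firstHit {x | x ∈ m} ⟨v, hl.last_mem, hm.head_mem⟩
  obtain ⟨m1, m2, e', -, h4⟩ := hm.split hx
  refine ⟨(l1 ++ [x]) ++ m2, h1.trans' h4 ?_, ?_⟩
  · intro y hy hy'
    have hym : y ∈ m := by rw [e']; simp [hy]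
    have : y ∈ l1 ∨ y = x := by simpa using hy'
    rcases this with h | h
    · exact h2 y h hym
    · subst h
      have := h4.nodup
      simp at this
      exact this.1 hy
  · intro y hy
    simp only [List.mem_append, List.mem_singleton] at hy
    rcases hy with (h | h) | h
    · exact hlS y (by rw [e]; simp [h])
    · exact hlS y (by rw [e]; simp [h])
    · exact hmS y (by rw [e']; simp [h])

/-- The set `K` induces a connected subgraph (path version). -/
def Conn (G : SimpleGraph V) (K : Set V) : Prop :=
  ∀ u ∈ K, ∀ v ∈ K, ∃ l, LP G u v l ∧ ∀ x ∈ l, x ∈ K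

/-- The component of `r` inside `S`. -/
def compIn (G : SimpleGraph V) (S : Set V) (r : V) : Set V :=
  {v | ∃ l, LP G r v l ∧ ∀ x ∈ l, x ∈ S}

theorem compIn_self {S : Set V} {r : V} (hr : r ∈ S) : r ∈ compIn G S r :=
  ⟨[r], LP.sing r, by simpa using hr⟩

theorem compIn_sub {S : Set V} {r : V} : compIn G S r ⊆ S := by
  rintro v ⟨l, hl, hS⟩
  exact hS v hl.last_mem

theorem compIn_closed {S : Set V} {r v w : V} (hv : v ∈ compIn G S r) (hw : w ∈ S)
    (hadj : G.Adj v w) : w ∈ compIn G S r := by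
  have hvS := compIn_sub hv
  obtain ⟨l, hl, hS⟩ := hv
  exact hl.concat ((LP.sing w).cons hadj (by simpa using hadj.ne)) hS (by simp [hvS, hw])

theorem compIn_eq {S : Set V} {r v : V} (hv : v ∈ compIn G S r) :
    compIn G S v = compIn G S r := by
  obtain ⟨l, hl, hS⟩ := hv
  ext w
  constructor
  · rintro ⟨m, hm, hmS⟩
    exact hl.concat hm hS hmS
  · rintro ⟨m, hm, hmS⟩
    exact hl.rev.concat hm (by simpa using hS) hmS

theorem compIn_conn (S : Set V) (r : V) : Conn G (compIn G S r) := by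
  intro u hu v hv
  rw [← compIn_eq hu] at hv
  obtain ⟨l, hl, hS⟩ := hv
  refine ⟨l, hl, ?_⟩
  intro x hx
  rw [← compIn_eq hu]
  obtain ⟨l1, l2, e, h1, -⟩ := hl.split hx
  refine ⟨_, h1, ?_⟩
  intro y hy
  apply hS
  rw [e]
  simp at hy ⊢
  tauto

/-- Size bound used for the component lemma. -/
def NC (M : ℕ) : ℕ → ℕ
  | 0 => 1
  | l + 1 => 1 + (M + 1) * NC M l

theorem NC_pos (M l : ℕ) : 1 ≤ NC M l := by
  cases l <;> simp [NC]

theorem many_aux [Finite V] (M : ℕ) : ∀ (ℓ : ℕ) (U : Set V) (r : V), r ∈ U → Conn G U →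
    (∀ v l, LP G r v l → (∀ x ∈ l, x ∈ U) → l.length ≤ ℓ) → NC M ℓ ≤ U.ncard →
    ∃ Y : Finset V, Y.card ≤ ℓ ∧ ∃ K : Fin M → Set V, (∀ i, (K i).Nonempty) ∧
      (∀ i, K i ⊆ U) ∧ (∀ i, ∀ v ∈ K i, v ∉ Y) ∧ (∀ i, Conn G (K i)) ∧ (∀ i j, i ≠ j → Disjoint (K i) (K j)) ∧
      (∀ i, ∀ v ∈ K i, ∀ w ∈ U, G.Adj v w → w ∈ K i ∨ w ∈ Y) := by
  classical
  intro ℓ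
  induction ℓ with
  | zero =>
    intro U r hr _ hp _
    have := hp r [r] (LP.sing r) (by simpa using hr)
    simp at this
  | succ ℓ ih =>
    intro U r hr hU hp hN
    let S : Finset V := (Set.toFinite (U \ {r})).toFinset
    have hS : ∀ v, v ∈ S ↔ v ∈ U ∧ v ≠ r := by intro v; simp [S]
    have hScard : (M + 1) * NC M ℓ ≤ S.card := by
      have h1 : S.card = (U \ {r}).ncard := (Set.ncard_eq_toFinset_card _ _).symm
      have h2 := Set.ncard_sdiff_singleton_add_one hr (Set.toFinite U)
      simp only [NC] at hN
      omega
    let C := S.image (compIn G (U \ {r}))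
    by_cases hC : M ≤ C.card
    · let f : Fin M → C := fun i => C.equivFin.symm (Fin.castLE hC i)
      have hf : Function.Injective f := fun i j hij => by
        simpa [f] using hij
      have hfm : ∀ i, ∃ v ∈ U \ {r}, (f i : Set V) = compIn G (U \ {r}) v := by
        intro i
        obtain ⟨v, hv, e⟩ := Finset.mem_image.1 (f i).2
        exact ⟨v, by simpa using (hS v).1 hv, e.symm⟩
      refine ⟨{r}, by simp, fun i => f i, ?_, ?_, ?_, ?_, ?_, ?_⟩
      · intro i
        obtain ⟨v, hv, e⟩ := hfm i
        simp only [e]; exact ⟨v, compIn_self hv⟩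
      · intro i
        obtain ⟨v, hv, e⟩ := hfm i
        simp only [e]
        exact compIn_sub.trans Set.sdiff_subset
      · intro i v hv
        obtain ⟨v', hv', e⟩ := hfm i
        simp only [e] at hv
        have := compIn_sub hv
        simpa using this.2
      · intro i
        obtain ⟨v', hv', e⟩ := hfm i
        simp only [e]; exact compIn_conn _ _
      · intro i j hij
        obtain ⟨v, hv, e⟩ := hfm i
        obtain ⟨v', hv', e'⟩ := hfm j
        rw [Set.disjoint_left]
        intro w hw hw'
        apply hij
        apply hf
        apply Subtype.ext
        simp only [e] at hw ⊢
        simp only [e'] at hw' ⊢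
        rw [← compIn_eq hw, ← compIn_eq hw']
      · intro i v hv w hw hadj
        obtain ⟨v', hv', e⟩ := hfm i
        by_cases hwr : w = r
        · right; simp [hwr]
        · left
          simp only [e] at hv ⊢
          exact compIn_closed hv ⟨hw, by simpa using hwr⟩ hadj
    · have hpos := NC_pos M ℓ
      have hSne : S.Nonempty := by
        rw [← Finset.card_pos]
        have : 1 ≤ (M+1) * NC M ℓ := Nat.mul_pos (by omega) hpos
        omega
      have hCS : C.card * NC M ℓ ≤ S.card :=
        (Nat.mul_le_mul_right _ (by omega)).trans hScard
      obtain ⟨D, hD, hDc⟩ := Finset.exists_le_card_fiber_of_mul_le_card_of_maps_to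
        (f := compIn G (U \ {r})) (fun a ha => Finset.mem_image_of_mem _ ha) (hSne.image _) hCS
      obtain ⟨v0, hv0, rfl⟩ := Finset.mem_image.1 hD
      obtain ⟨hv0U, hv0r⟩ := (hS _).1 hv0
      have hDc' : NC M ℓ ≤ (compIn G (U \ {r}) v0).ncard := by
        refine hDc.trans ?_
        rw [← Set.ncard_coe_finset]
        apply Set.ncard_le_ncard _ (Set.toFinite _)
        intro x hx
        simp only [Finset.coe_filter, Set.mem_ofPred_eq] at hx
        rw [← hx.2]
        exact compIn_self (by simpa using (hS x).1 hx.1)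
      obtain ⟨l, hl, hlU⟩ := hU r hr v0 hv0U
      obtain ⟨l', rfl⟩ := hl.eq_cons
      cases l' with
      | nil =>
        have := hl.last
        simp at this
        exact absurd this.symm hv0r
      | cons w l' =>
        obtain ⟨h1, h2, h3⟩ := hl.tail
        have hw : w ∈ compIn G (U \ {r}) v0 := by
          refine ⟨_, h1.rev, ?_⟩
          intro x hx
          have hx := List.mem_reverse.1 hx
          refine ⟨hlU x (List.mem_cons_of_mem _ hx), ?_⟩
          rintro rfl
          exact h3 hx
        obtain ⟨Y, hY, K, k1, hM, k2, k3, k4, k5⟩ := ih (compIn G (U \ {r}) v0) w hw (compIn_conn _ _) (by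
          intro v l hl hlD
          have hrl : r ∉ l := fun h => (compIn_sub (hlD r h)).2 rfl
          have := hp v (r :: l) (hl.cons h2 hrl) (by
            intro x hx
            rcases List.mem_cons.1 hx with rfl | hx
            · exact hr
            · exact (compIn_sub (hlD x hx)).1)
          simp at this
          omega) hDc'
        · refine ⟨insert r Y, (Finset.card_insert_le _ _).trans (by omega), K, k1,
            fun i => (hM i).trans (compIn_sub.trans Set.sdiff_subset), ?_, k3, k4, ?_⟩
          · intro i v hv hvY
            rcases Finset.mem_insert.1 hvY with rfl | h
            · exact (compIn_sub (hM i hv)).2 rfl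
            · exact k2 i v hv h
          · intro i v hv u hu hadj
            by_cases hur : u = r
            · right; simp [hur]
            · have := compIn_closed (hM i hv) ⟨hu, by simpa using hur⟩ hadj
              rcases k5 i v hv u this hadj with h | h
              · left; exact h
              · right; simp [h]

theorem many_comps [Fintype V] (M ℓ : ℕ) (h2 : TwoConnected G)
    (hp : ∀ u v l, LP G u v l → l.length ≤ ℓ) (hN : NC (2 ^ ℓ * M) ℓ ≤ Fintype.card V) :
    ∃ (X : Finset V) (K : Fin M → Set V), (∀ i, (K i).Nonempty) ∧
      (∀ i, ∀ v ∈ K i, v ∉ X) ∧ (∀ i, Conn G (K i)) ∧ (∀ i j, i ≠ j → Disjoint (K i) (K j)) ∧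
      (∀ i, ∀ v ∈ K i, ∀ w, G.Adj v w → w ∈ K i ∨ w ∈ X) ∧
      (∀ i, ∀ x ∈ X, ∃ v ∈ K i, G.Adj x v) := by
  classical
  have hcard : 0 < Fintype.card V := by have := h2.1; omega
  obtain ⟨r⟩ := Fintype.card_pos_iff.1 hcard
  have hconn : Conn G Set.univ := by
    intro u _ v _
    obtain ⟨p⟩ := h2.2.1.preconnected u v
    obtain ⟨l, hl, -⟩ := Walk.exists_LP p
    exact ⟨l, hl, by simp⟩
  obtain ⟨Y, hY, K, k1, -, k2, k3, k4, k5⟩ := many_aux (G := G) (2 ^ ℓ * M) ℓ Set.univ r trivial hconn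
    (fun v l hl _ => hp r v l hl) (by simpa [Set.ncard_univ] using hN)
  let f : Fin (2 ^ ℓ * M) → Finset V := fun i => Y.filter (fun y => ∃ v ∈ K i, G.Adj y v)
  obtain ⟨X, hX, hXc⟩ := Finset.exists_le_card_fiber_of_mul_le_card_of_maps_to
    (s := Finset.univ) (t := Y.powerset) (f := f) (n := M)
    (fun i _ => Finset.mem_powerset.2 (Finset.filter_subset _ _)) ⟨∅, by simp⟩ (by
      rw [Finset.card_powerset, Finset.card_univ, Fintype.card_fin]
      exact Nat.mul_le_mul_right _ (Nat.pow_le_pow_right (by omega) hY))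
  set J := Finset.univ.filter (fun i => f i = X) with hJ
  let g : Fin M → J := fun i => J.equivFin.symm (Fin.castLE hXc i)
  have hg : Function.Injective g := fun i j hij => by simpa [g] using hij
  have hgX : ∀ i, f (g i) = X := fun i => by
    exact (Finset.mem_filter.1 (g i).2).2
  refine ⟨X, fun i => K (g i), fun i => k1 _, ?_, fun i => k3 _, ?_, ?_, ?_⟩
  · intro i v hv hvX
    exact k2 _ v hv (Finset.mem_powerset.1 hX hvX)
  · intro i j hij
    apply k4
    intro h
    exact hij (hg (Subtype.ext h))
  · intro i v hv w hadj
    rcases k5 _ v hv w trivial hadj with h | h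
    · exact Or.inl h
    · right
      rw [← hgX i]
      exact Finset.mem_filter.2 ⟨h, v, hv, hadj.symm⟩
  · intro i x hx
    rw [← hgX i] at hx
    exact (Finset.mem_filter.1 hx).2

end Comps


section Fill

variable {V : Type*} {G : SimpleGraph V}

theorem fill {ι : Type*} [DecidableEq ι] (X : Set V) (K : ι → Set V)
    (hKX : ∀ i, ∀ v ∈ K i, v ∉ X) (hKd : ∀ i j, i ≠ j → Disjoint (K i) (K j))
    (hbr : ∀ i, ∀ a ∈ X, ∀ b ∈ X, ∃ f g E, LP G f g E ∧ (∀ v ∈ E, v ∈ K i) ∧ G.Adj a f ∧ G.Adj g b) :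
    ∀ (rest : List V) (a : V) (I : Finset ι), (a :: rest).Nodup → (∀ v ∈ a :: rest, v ∈ X) →
      rest.length ≤ I.card → ∃ l, LP G a ((a :: rest).getLast (by simp)) l ∧
        2 * rest.length + 1 ≤ l.length ∧ ∀ v ∈ l, v ∈ a :: rest ∨ ∃ i ∈ I, v ∈ K i := by
  intro rest
  induction rest with
  | nil =>
    intro a I _ _ _
    exact ⟨[a], LP.sing a, by simp, by simp⟩
  | cons b rest ih =>
    intro a I hnd hX hI
    simp only [List.length_cons] at hI
    obtain ⟨i, hi⟩ := Finset.card_pos.1 (show 0 < I.card by omega)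
    obtain ⟨l, hl, hlen, hmem⟩ := ih b (I.erase i) (List.nodup_cons.1 hnd).2
      (fun v hv => hX v (List.mem_cons_of_mem _ hv)) (by rw [Finset.card_erase_of_mem hi]; omega)
    obtain ⟨f, g, E, hE, hEK, haf, hgb⟩ := hbr i a (hX a (by simp)) b (hX b (by simp))
    have s1 : LP G f ((b :: rest).getLast (by simp)) (E ++ l) := by
      refine hE.join hl hgb ?_
      intro v hv hvl
      rcases hmem v hvl with h | ⟨j, hj, h⟩
      · exact hKX i v (hEK v hv) (hX v (List.mem_cons_of_mem _ h))
      · exact Set.disjoint_left.1 (hKd i j (Finset.ne_of_mem_erase hj).symm) (hEK v hv) h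
    have haE : a ∉ E ++ l := by
      intro h
      rcases List.mem_append.1 h with h | h
      · exact hKX i a (hEK a h) (hX a (by simp))
      · rcases hmem a h with h | ⟨j, hj, h⟩
        · exact (List.nodup_cons.1 hnd).1 h
        · exact hKX j a h (hX a (by simp))
    have hE1 := List.length_pos_iff.2 hE.ne_nil
    refine ⟨a :: (E ++ l), ?_, ?_, ?_⟩
    · simpa using s1.cons haf haE
    · simp; omega
    · intro v hv
      rcases List.mem_cons.1 hv with rfl | hv
      · left; simp
      · rcases List.mem_append.1 hv with h | h
        · right; exact ⟨i, hi, hEK v h⟩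
        · rcases hmem v h with h | ⟨j, hj, h⟩
          · left; exact List.mem_cons_of_mem _ h
          · right; exact ⟨j, Finset.mem_of_mem_erase hj, h⟩

theorem fill_cycle {M t : ℕ} (ht : 1 ≤ t) (hM : t + 1 ≤ M) (X : Finset V) (K : Fin M → Set V)
    (hKX : ∀ i, ∀ v ∈ K i, v ∉ X) (hKd : ∀ i j, i ≠ j → Disjoint (K i) (K j))
    (hbr : ∀ i, ∀ a ∈ X, ∀ b ∈ X, ∃ f g E, LP G f g E ∧ (∀ v ∈ E, v ∈ K i) ∧ G.Adj a f ∧ G.Adj g b)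
    (hX : t + 1 ≤ X.card) : HasCycleGE G (2 * t + 2) := by
  classical
  obtain ⟨X', hX', hc⟩ := Finset.exists_subset_card_eq hX
  have hnd := X'.nodup_toList
  have hlen := X'.length_toList
  have hmem : ∀ v, v ∈ X'.toList → v ∈ X := fun v h => hX' (Finset.mem_toList.1 h)
  cases hL : X'.toList with
  | nil => rw [hL] at hlen; simp at hlen; omega
  | cons a rest =>
    rw [hL] at hnd hlen hmem
    let i0 : Fin M := ⟨0, by omega⟩
    have hI : rest.length ≤ ((Finset.univ : Finset (Fin M)).erase i0).card := by
      rw [Finset.card_erase_of_mem (Finset.mem_univ _), Finset.card_univ, Fintype.card_fin]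
      simp at hlen; omega
    obtain ⟨l, hl, hll, hlm⟩ := fill (G := G) (↑X) K (by simpa using hKX) hKd (by simpa using hbr) rest a
      (Finset.univ.erase i0) hnd hmem hI
    have hz := hmem _ (List.getLast_mem (l := a :: rest) (by simp))
    obtain ⟨f, g, E, hE, hEK, h1, h2⟩ := hbr i0 _ hz a (hmem a (by simp))
    have hE1 := List.length_pos_iff.2 hE.ne_nil
    simp only [List.length_cons] at hlen
    refine (hl.join hE h1 ?_).hasCycle h2 (by simp; omega) (by simp; omega)
    intro v hv hvE
    rcases hlm v hv with h | ⟨j, hj, h⟩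
    · exact hKX i0 v (hEK v hvE) (hmem v h)
    · exact Set.disjoint_left.1 (hKd i0 j (Finset.ne_of_mem_erase hj).symm) (hEK v hvE) h

end Fill

section Count

variable {V : Type*} {G : SimpleGraph V}

theorem peel [Finite V] {U : Set V} {v : V} (hv : v ∉ U) :
    edgesWithin G (insert v U) = edgesWithin G U + degOn G U v := by
  have e : {e ∈ G.edgeSet | ∀ x ∈ e, x ∈ insert v U}
      = {e ∈ G.edgeSet | ∀ x ∈ e, x ∈ U} ∪ (fun x => s(v, x)) '' {x ∈ U | G.Adj v x} := by
    ext e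
    induction e using Sym2.ind with
    | _ x y =>
    simp only [Set.mem_ofPred_eq, SimpleGraph.mem_edgeSet, Sym2.mem_iff, forall_eq_or_imp, forall_eq,
      Set.mem_insert_iff, Set.mem_union, Set.mem_image, Sym2.eq_iff]
    constructor
    · rintro ⟨hadj, hx | hx, hy | hy⟩
      · subst hx; subst hy; exact absurd hadj (G.loopless.irrefl _)
      · subst hx; right; exact ⟨y, ⟨hy, hadj⟩, Or.inl ⟨rfl, rfl⟩⟩
      · subst hy; right; exact ⟨x, ⟨hx, hadj.symm⟩, Or.inr ⟨rfl, rfl⟩⟩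
      · left; exact ⟨hadj, hx, hy⟩
    · rintro (⟨h, hx, hy⟩ | ⟨z, ⟨hz, hadj⟩, ⟨rfl, rfl⟩ | ⟨rfl, rfl⟩⟩)
      · exact ⟨h, Or.inr hx, Or.inr hy⟩
      · exact ⟨hadj, Or.inl rfl, Or.inr hz⟩
      · exact ⟨hadj.symm, Or.inr hz, Or.inl rfl⟩
  unfold edgesWithin degOn
  rw [e, Set.ncard_union_eq _ (Set.toFinite _) (Set.toFinite _), Set.ncard_image_of_injective]
  · intro a b hab
    have : a = b ∨ v = b ∧ a = v := by simpa using hab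
    rcases this with h | ⟨h1, h2⟩
    · exact h
    · exact h2.trans h1
  · rw [Set.disjoint_left]
    rintro _ ⟨-, h⟩ ⟨z, -, rfl⟩
    exact hv (h v (by simp))

theorem edgesWithin_univ : edgesWithin G Set.univ = edgeCount G := by
  simp [edgesWithin, edgeCount]

theorem edgesWithin_empty : edgesWithin G ∅ = 0 := by
  unfold edgesWithin
  convert Set.ncard_empty (Sym2 V)
  ext e
  induction e using Sym2.ind with
  | _ x y =>
    simp only [Set.mem_ofPred_eq, Set.mem_empty_iff_false, iff_false, not_and]
    intro _ h
    exact h x (by simp)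

theorem edges_add [Finite V] {c : ℕ} {S : Set V} (T : Finset V) (hd : ∀ v ∈ T, v ∉ S)
    (h : ∀ v ∈ T, degOn G (S ∪ T) v ≤ c) : edgesWithin G (S ∪ T) ≤ edgesWithin G S + c * T.card := by
  classical
  induction T using Finset.induction_on with
  | empty => simp
  | insert v T hv ih =>
    have e : S ∪ ((insert v T : Finset V) : Set V) = insert v (S ∪ T) := by
      rw [Finset.coe_insert, Set.union_insert]
    have hsub : S ∪ (T : Set V) ⊆ S ∪ ((insert v T : Finset V) : Set V) := by
      rw [e]; exact Set.subset_insert _ _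
    have h1 := ih (fun w hw => hd w (Finset.mem_insert_of_mem hw)) (fun w hw =>
      (degOn_mono_set hsub w).trans (h w (Finset.mem_insert_of_mem hw)))
    have h2 := (degOn_mono_set (G := G) hsub v).trans (h v (Finset.mem_insert_self _ _))
    rw [e, peel (by simp [hv, hd v (Finset.mem_insert_self _ _)]), Finset.card_insert_of_notMem hv]
    rw [mul_add]
    omega

theorem edges_add_ge [Finite V] {c : ℕ} {S : Set V} (T : Finset V) (hd : ∀ v ∈ T, v ∉ S)
    (h : ∀ v ∈ T, c ≤ degOn G S v) : edgesWithin G S + c * T.card ≤ edgesWithin G (S ∪ T) := by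
  classical
  induction T using Finset.induction_on with
  | empty => simp
  | insert v T hv ih =>
    have e : S ∪ ((insert v T : Finset V) : Set V) = insert v (S ∪ T) := by
      rw [Finset.coe_insert, Set.union_insert]
    have h1 := ih (fun w hw => hd w (Finset.mem_insert_of_mem hw)) (fun w hw =>
      h w (Finset.mem_insert_of_mem hw))
    have h2 := (h v (Finset.mem_insert_self _ _)).trans
      (degOn_mono_set (G := G) (Set.subset_union_left (t := (T : Set V))) v)
    rw [e, peel (by simp [hv, hd v (Finset.mem_insert_self _ _)]), Finset.card_insert_of_notMem hv]
    rw [mul_add]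
    omega

theorem edgesWithin_le [Finite V] (W : Finset V) : edgesWithin G (W : Set V) ≤ W.card * W.card := by
  have := edges_add (G := G) (S := ∅) (c := W.card) W (by simp) (by
    intro v hv
    rw [← Set.ncard_coe_finset]
    apply Set.ncard_le_ncard _ (Set.toFinite _)
    intro x hx
    simpa using hx.1)
  simpa [edgesWithin_empty] using this

theorem count_bad [Finite V] {M t : ℕ} (ht : 1 ≤ t) (W : Set V)
    (hW : ∀ U : Set V, U.Nonempty → Disjoint U W → ∃ v ∈ U, degOn G (U ∪ W) v ≤ t)
    (X : Set V) (K : Fin M → Set V)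
    (hKd : ∀ i j, i ≠ j → Disjoint (K i) (K j))
    (hcl : ∀ i, ∀ v ∈ K i, ∀ w, G.Adj v w → w ∈ K i ∨ w ∈ X)
    (bad : Set (Fin M)) (hb1 : ∀ i ∈ bad, Disjoint (K i) W)
    (hb2 : ∀ i ∈ bad, ∀ v ∈ K i, degOn G X v < t) :
    ∀ (n : ℕ) (U : Set V), U.ncard = n → Disjoint U W →
      edgesWithin G (U ∪ W) + {i ∈ bad | (K i ∩ U).Nonempty}.ncard ≤ edgesWithin G W + t * n := by
  intro n
  induction n with
  | zero =>
    intro U hU _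
    rw [Set.ncard_eq_zero] at hU
    subst hU
    simp
  | succ n ih =>
    intro U hU hd
    have hne : U.Nonempty := Set.nonempty_of_ncard_ne_zero (by omega)
    obtain ⟨v, hv, hdeg⟩ := hW U hne hd
    have hd' : Disjoint (U \ {v}) W := hd.mono_left Set.sdiff_subset
    have hUn := Set.ncard_sdiff_singleton_add_one hv (Set.toFinite U)
    have h1 := ih (U \ {v}) (by omega) hd'
    have hvW : v ∉ W := Set.disjoint_left.1 hd hv
    have hvn : v ∉ (U \ {v}) ∪ W := by simp [hvW]
    have e : U ∪ W = insert v ((U \ {v}) ∪ W) := by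
      rw [← Set.insert_union, Set.insert_sdiff_singleton, Set.insert_eq_of_mem hv]
    rw [e, peel hvn]
    have hdeg' : degOn G ((U \ {v}) ∪ W) v ≤ t :=
      (degOn_mono_set (by rw [e]; exact Set.subset_insert _ _) v).trans hdeg
    by_cases hnew : ∃ i ∈ bad, v ∈ K i ∧ K i ∩ (U \ {v}) = ∅
    · obtain ⟨i, hi, hvi, hem⟩ := hnew
      have hsub : {i ∈ bad | (K i ∩ U).Nonempty} ⊆ insert i {i ∈ bad | (K i ∩ (U \ {v})).Nonempty} := by
        rintro j ⟨hj, x, hxj, hxU⟩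
        by_cases hji : j = i
        · left; exact hji
        · right
          refine ⟨hj, x, hxj, hxU, ?_⟩
          rintro rfl
          exact Set.disjoint_left.1 (hKd j i hji) hxj hvi
      have h2 := (Set.ncard_le_ncard hsub (Set.toFinite _)).trans (Set.ncard_insert_le _ _)
      have h3 : degOn G ((U \ {v}) ∪ W) v ≤ degOn G X v := by
        apply Set.ncard_le_ncard _ (Set.toFinite _)
        rintro x ⟨hx, hadj⟩
        refine ⟨?_, hadj⟩
        rcases hcl i v hvi x hadj with h | h
        · exfalso
          rcases hx with hx | hx
          · have : x ∈ K i ∩ (U \ {v}) := ⟨h, hx⟩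
            rw [hem] at this
            exact this
          · exact Set.disjoint_left.1 (hb1 i hi) h hx
        · exact h
      have h4 := hb2 i hi v hvi
      rw [mul_add]
      omega
    · have hsub : {i ∈ bad | (K i ∩ U).Nonempty} ⊆ {i ∈ bad | (K i ∩ (U \ {v})).Nonempty} := by
        rintro j ⟨hj, x, hxj, hxU⟩
        refine ⟨hj, ?_⟩
        by_cases hxv : x = v
        · subst hxv
          by_contra hcon
          exact hnew ⟨j, hj, hxj, Set.not_nonempty_iff_eq_empty.1 hcon⟩
        · exact ⟨x, hxj, hxU, hxv⟩
      have h2 := Set.ncard_le_ncard hsub (Set.toFinite _)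
      rw [mul_add]
      omega

/-- Threshold for the first structure theorem. -/
def N1 (t M : ℕ) : ℕ :=
  NC (2 ^ ((2 * t + 2) * (2 * t + 2) + 3) *
    (M + (2 * t + 1) * (2 * t + 1) + t * t + 2 * t + 1 + t + 1)) ((2 * t + 2) * (2 * t + 2) + 3)

theorem structure1 [Fintype V] {t : ℕ} (ht : 1 ≤ t) (M : ℕ) (hM : 1 ≤ M) (h2 : TwoConnected G)
    (hc : ¬ HasCycleGE G (2 * t + 2)) (hN : N1 t M ≤ Fintype.card V)
    (he : t * Fintype.card V ≤ edgeCount G + t * t) :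
    ∃ (A : Finset V) (K : Fin M → Set V) (b : Fin M → V), A.card = t ∧
      (∀ i, ∀ v ∈ K i, v ∉ A) ∧ (∀ i j, i ≠ j → Disjoint (K i) (K j)) ∧
      (∀ i, ∀ v ∈ K i, ∀ w, G.Adj v w → w ∈ K i ∨ w ∈ A) ∧
      (∀ i, b i ∈ K i) ∧ (∀ i, ∀ a ∈ A, G.Adj (b i) a) := by
  classical
  obtain ⟨M', hM'⟩ : ∃ M', M' = (M + (2 * t + 1) * (2 * t + 1) + t * t + 2 * t + 1 + t + 1) := ⟨_, rfl⟩
  rw [N1, ← hM'] at hN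
  obtain ⟨X, K, k1, k2, k3, k4, k5, k6⟩ := many_comps _ _ h2
    (fun u v l hl => h2.path_bound (by omega) hc hl) hN
  have hXt : X.card ≤ t := by
    by_contra hcon
    push Not at hcon
    refine hc (fill_cycle ht (M := M') (by omega) X K k2 k4 ?_ hcon)
    intro i a ha b hb
    obtain ⟨f, hf, haf⟩ := k6 i a ha
    obtain ⟨g, hg, hbg⟩ := k6 i b hb
    obtain ⟨E, hE, hEK⟩ := k3 i f hf g hg
    exact ⟨f, g, E, hE, hEK, haf, hbg.symm⟩
  obtain ⟨W, hWc, hW⟩ := degeneracy h2 ht hc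
  let bad : Set (Fin M') := {i | Disjoint (K i) W ∧ ∀ v ∈ K i, degOn G X v < t}
  let meet : Set (Fin M') := {i | ¬ Disjoint (K i) W}
  have hbad : bad.ncard ≤ (2 * t + 1) * (2 * t + 1) + t * t := by
    have h3 := count_bad ht W hW (X : Set V) K k4 k5 bad (fun i hi => hi.1) (fun i hi => hi.2) _ Wᶜ rfl
      disjoint_compl_left
    rw [Set.compl_union_self, edgesWithin_univ] at h3
    have e : {i ∈ bad | (K i ∩ Wᶜ).Nonempty} = bad := by
      ext i
      constructor
      · exact fun h => h.1
      · intro h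
        obtain ⟨x, hx⟩ := k1 i
        exact ⟨h, x, hx, Set.disjoint_left.1 h.1 hx⟩
    rw [e] at h3
    have h4 : edgesWithin G W ≤ (2 * t + 1) * (2 * t + 1) := by
      have := edgesWithin_le (G := G) (Set.toFinite W).toFinset
      rw [← Set.ncard_eq_toFinset_card W, Set.Finite.coe_toFinset] at this
      exact this.trans (Nat.mul_le_mul hWc hWc)
    have h5 : (Wᶜ).ncard ≤ Fintype.card V := by
      rw [← Nat.card_eq_fintype_card]; exact Set.ncard_le_card _
    have h6 : t * (Wᶜ).ncard ≤ t * Fintype.card V := Nat.mul_le_mul_left _ h5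
    omega
  have hmeet : meet.ncard ≤ 2 * t + 1 := by
    refine le_trans ?_ hWc
    have : ∀ i : meet, ∃ w, w ∈ K i ∧ w ∈ W := fun i => by
      have := i.2
      exact Set.not_disjoint_iff.1 this
    choose w hw1 hw2 using this
    have hinj : Function.Injective (fun i : meet => (⟨w i, hw2 i⟩ : W)) := by
      intro i j hij
      have hij : w i = w j := congrArg Subtype.val hij
      by_contra hne
      have := k4 i j (fun h => hne (Subtype.ext h))
      exact Set.disjoint_left.1 this (hw1 i) (hij ▸ hw1 j)
    exact Nat.card_le_card_of_injective _ hinj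
  let good : Finset (Fin M') := (Set.toFinite (bad ∪ meet)ᶜ).toFinset
  have hgood : M ≤ good.card := by
    have h3 : good.card = ((bad ∪ meet)ᶜ).ncard := (Set.ncard_eq_toFinset_card _ _).symm
    have h4 := Set.ncard_add_ncard_compl (bad ∪ meet)
    have h5 := Set.ncard_union_le bad meet
    rw [Nat.card_eq_fintype_card, Fintype.card_fin] at h4
    omega
  let g : Fin M → good := fun i => good.equivFin.symm (Fin.castLE hgood i)
  have hg : Function.Injective g := fun i j hij => by simpa [g] using hij
  have hgv : ∀ i, ∃ v ∈ K (g i), t ≤ degOn G X v := by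
    intro i
    have := (g i).2
    simp only [good, Set.Finite.mem_toFinset, Set.mem_compl_iff, Set.mem_union, not_or] at this
    obtain ⟨h3, h4⟩ := this
    have h4 : Disjoint (K (g i)) W := by
      by_contra h; exact h4 h
    by_contra hcon
    push Not at hcon
    exact h3 ⟨h4, hcon⟩
  choose b hbK hbt using hgv
  have hbX : ∀ i, ∀ a ∈ X, G.Adj (b i) a ∧ X.card = t := by
    intro i a ha
    have hsub : {x ∈ (X : Set V) | G.Adj (b i) x} ⊆ X := fun x hx => hx.1
    have hXn : (X : Set V).ncard = X.card := Set.ncard_coe_finset X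
    have hb3 : t ≤ {x ∈ (X : Set V) | G.Adj (b i) x}.ncard := hbt i
    have h4 := Set.ncard_le_ncard hsub (Set.toFinite _)
    have := Set.eq_of_subset_of_ncard_le hsub (by omega) (Set.toFinite _)
    have h5 : a ∈ {x ∈ (X : Set V) | G.Adj (b i) x} := by rw [this]; exact ha
    exact ⟨h5.2, by omega⟩
  have hXc : X.card = t := by
    have hb3 : t ≤ {x ∈ (X : Set V) | G.Adj (b ⟨0, hM⟩) x}.ncard := hbt ⟨0, hM⟩
    have hsub : {x ∈ (X : Set V) | G.Adj (b ⟨0, hM⟩) x} ⊆ X := fun x hx => hx.1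
    have h4 := Set.ncard_le_ncard hsub (Set.toFinite _)
    have hXn : (X : Set V).ncard = X.card := Set.ncard_coe_finset X
    omega
  refine ⟨X, fun i => K (g i), b, hXc, fun i => k2 _, ?_, fun i => k5 _, hbK, fun i a ha => (hbX i a ha).1⟩
  intro i j hij
  apply k4
  intro h
  exact hij (hg (Subtype.ext h))

end Count


section Struct

variable {V : Type*} {G : SimpleGraph V}

theorem fill_b {M : ℕ} (A : Finset V) (b : Fin M → V) (hbA : ∀ i, b i ∉ A)
    (hbi : Function.Injective b) (hb : ∀ i, ∀ a ∈ A, G.Adj (b i) a)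
    (rest : List V) (a : V) (I : Finset (Fin M)) (hnd : (a :: rest).Nodup)
    (hA : ∀ v ∈ a :: rest, v ∈ A) (hI : rest.length ≤ I.card) :
    ∃ l, LP G a ((a :: rest).getLast (by simp)) l ∧
        2 * rest.length + 1 ≤ l.length ∧ ∀ v ∈ l, v ∈ a :: rest ∨ ∃ i ∈ I, v = b i := by
  obtain ⟨l, h1, h2, h3⟩ := fill (G := G) (A : Set V) (fun i => {b i}) (by
      rintro i v rfl; exact hbA i) (by
      intro i j hij
      rw [Set.disjoint_singleton]
      exact fun h => hij (hbi h)) (by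
      intro i a ha c hc
      exact ⟨b i, b i, [b i], LP.sing _, by simp, (hb i a ha).symm, hb i c hc⟩) rest a I hnd hA hI
  exact ⟨l, h1, h2, h3⟩

theorem LP.subset_closed {A K : Set V} (hcl : ∀ v ∈ K, ∀ w, G.Adj v w → w ∈ K ∨ w ∈ A) :
    ∀ {l : List V} {u v : V}, LP G u v l → (∀ x ∈ l, x ∉ A) → u ∈ K → ∀ x ∈ l, x ∈ K := by
  intro l
  induction l with
  | nil => intro u v _ _ _ x hx; simp at hx
  | cons a l ih =>
    intro u v hl hA hu x hx
    have ha : a = u := by simpa using hl.head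
    subst ha
    rcases List.mem_cons.1 hx with rfl | hx
    · exact hu
    · cases l with
      | nil => simp at hx
      | cons c l =>
        obtain ⟨h1, h2, -⟩ := hl.tail
        refine ih h1 (fun y hy => hA y (List.mem_cons_of_mem _ hy)) ?_ x hx
        rcases hcl a hu c h2 with h | h
        · exact h
        · exact absurd h (hA c (by simp))

theorem C2 {M t : ℕ} (hM : t + 5 ≤ M) (hc : ¬ HasCycleGE G (2 * t + 2))
    (A : Finset V) (hAt : A.card = t) (K : Fin M → Set V) (b : Fin M → V)
    (hKA : ∀ i, ∀ v ∈ K i, v ∉ A) (hKd : ∀ i j, i ≠ j → Disjoint (K i) (K j))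
    (hcl : ∀ i, ∀ v ∈ K i, ∀ w, G.Adj v w → w ∈ K i ∨ w ∈ A)
    (hbK : ∀ i, b i ∈ K i) (hb : ∀ i, ∀ a ∈ A, G.Adj (b i) a)
    {f g : V} {L : List V} {a c : V} (hL : LP G f g L) (hLA : ∀ v ∈ L, v ∉ A) (hL3 : 3 ≤ L.length)
    (ha : a ∈ A) (hcA : c ∈ A) (haf : G.Adj a f) (hgc : G.Adj g c) : a = c := by
  classical
  by_contra hne
  have hbi : Function.Injective b := by
    intro i j hij
    by_contra h
    exact Set.disjoint_left.1 (hKd i j h) (hbK i) (hij ▸ hbK j)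
  obtain ⟨I, hIc, hIL⟩ : ∃ I : Finset (Fin M), t ≤ I.card ∧ ∀ i ∈ I, b i ∉ L := by
    have hall : ∀ i, b i ∈ L → ∀ x ∈ L, x ∈ K i := by
      intro i hi x hx
      obtain ⟨l1, l2, e, h1, h2⟩ := hL.split hi
      rw [e] at hx hLA
      have s1 := LP.subset_closed (hcl i) h1.rev (by
        intro y hy; exact hLA y (by simp at hy ⊢; tauto)) (hbK i)
      have s2 := LP.subset_closed (hcl i) h2 (by
        intro y hy; exact hLA y (by simp at hy ⊢; tauto)) (hbK i)
      rcases List.mem_append.1 hx with h | h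
      · exact s1 x (by simp [h])
      · exact s2 x h
    by_cases h : ∃ i, b i ∈ L
    · obtain ⟨i, hi⟩ := h
      refine ⟨Finset.univ.erase i, ?_, ?_⟩
      · rw [Finset.card_erase_of_mem (Finset.mem_univ _), Finset.card_univ, Fintype.card_fin]; omega
      · intro j hj hjL
        exact Set.disjoint_left.1 (hKd j i (Finset.ne_of_mem_erase hj)) (hbK j) (hall i hi _ hjL)
    · push Not at h
      exact ⟨Finset.univ, by rw [Finset.card_univ, Fintype.card_fin]; omega, fun i _ => h i⟩
  have hcard : ((A.erase a).erase c).card + 2 = t := by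
    rw [Finset.card_erase_of_mem (Finset.mem_erase.2 ⟨fun h => hne h.symm, hcA⟩),
      Finset.card_erase_of_mem ha]
    have : 2 ≤ A.card := by
      rw [← Finset.card_pair hne]
      apply Finset.card_le_card
      intro v hv
      rcases Finset.mem_insert.1 hv with rfl | hv
      · exact ha
      · rw [Finset.mem_singleton.1 hv]; exact hcA
    omega
  have hlt := ((A.erase a).erase c).length_toList
  obtain ⟨l, hl, hlen, hlm⟩ := fill_b A b (fun i => hKA i _ (hbK i)) hbi hb
    (((A.erase a).erase c).toList ++ [a]) c I (by
      rw [← List.cons_append, List.nodup_append]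
      refine ⟨?_, by simp, ?_⟩
      · rw [List.nodup_cons]
        exact ⟨by simp, Finset.nodup_toList _⟩
      · intro x hx y hy hxy
        simp at hx hy
        subst hxy; subst hy
        rcases hx with h | h
        · exact hne h
        · exact h.2.1 rfl) (by
      intro v hv
      simp only [List.mem_cons, List.mem_append, Finset.mem_toList, Finset.mem_erase,
        List.not_mem_nil, or_false] at hv
      rcases hv with rfl | ⟨-, -, h⟩ | rfl
      · exact hcA
      · exact h
      · exact ha) (by simp only [List.length_append, hlt, List.length_singleton]; omega)
  have hlast : (c :: (((A.erase a).erase c).toList ++ [a])).getLast (by simp) = a := by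
    rw [List.getLast_cons (by simp), List.getLast_append_singleton]
  rw [hlast] at hl
  simp only [List.length_append, hlt, List.length_singleton] at hlen
  refine hc ((hl.join hL haf ?_).hasCycle hgc ?_ ?_)
  · intro v hv hvL
    rcases hlm v hv with h | ⟨i, hi, rfl⟩
    · apply hLA v hvL
      simp only [List.mem_cons, List.mem_append, Finset.mem_toList, Finset.mem_erase,
        List.not_mem_nil, or_false] at h
      rcases h with rfl | ⟨-, -, h⟩ | rfl
      · exact hcA
      · exact h
      · exact ha
    · exact hIL i hi hvL
  · simp; omega
  · simp; omega

theorem C3 {M t : ℕ} (ht : 2 ≤ t) (hM : t + 5 ≤ M) (hc : ¬ HasCycleGE G (2 * t + 2))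
    (A : Finset V) (hAt : A.card = t) (b : Fin M → V) (hbA : ∀ i, b i ∉ A)
    (hbi : Function.Injective b) (hb : ∀ i, ∀ a ∈ A, G.Adj (b i) a)
    {x y z w : V} (hx : x ∉ A) (hy : y ∉ A) (hz : z ∉ A) (hw : w ∉ A)
    (hxy : G.Adj x y) (hzw : G.Adj z w) (fx : ∀ a ∈ A, G.Adj x a) (fy : ∀ a ∈ A, G.Adj y a)
    (fz : ∀ a ∈ A, G.Adj z a) (fw : ∀ a ∈ A, G.Adj w a)
    (h1 : x ≠ z) (h2 : x ≠ w) (h3 : y ≠ z) (h4 : y ≠ w) : False := by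
  classical
  obtain ⟨a1, ha1⟩ := Finset.card_pos.1 (show 0 < A.card by omega)
  have hcard : (A.erase a1).card + 1 = t := by
    rw [Finset.card_erase_of_mem ha1]; omega
  let I : Finset (Fin M) := Finset.univ.filter (fun i => b i ∉ ({x, y, z, w} : Finset V))
  have hI : t ≤ I.card := by
    have e := Finset.card_filter_add_card_filter_not (s := (Finset.univ : Finset (Fin M)))
      (fun i => b i ∉ ({x, y, z, w} : Finset V))
    have h5 : (Finset.univ.filter (fun i => ¬ b i ∉ ({x, y, z, w} : Finset V))).card
        ≤ ({x, y, z, w} : Finset V).card := by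
      apply Finset.card_le_card_of_injOn b
      · intro i hi
        exact not_not.1 (Finset.mem_filter.1 hi).2
      · exact hbi.injOn
    have h6 : ({x, y, z, w} : Finset V).card ≤ 4 := Finset.card_le_four
    rw [Finset.card_univ, Fintype.card_fin] at e
    have : I.card = (Finset.univ.filter (fun i => b i ∉ ({x, y, z, w} : Finset V))).card := rfl
    omega
  have hlt := (A.erase a1).length_toList
  have hnd := (A.erase a1).nodup_toList
  have hmem : ∀ v, v ∈ (A.erase a1).toList → v ≠ a1 ∧ v ∈ A := by
    intro v hv
    simpa using hv
  cases hL : (A.erase a1).toList with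
  | nil => rw [hL] at hlt; simp at hlt; omega
  | cons c rest =>
    rw [hL] at hlt hnd hmem
    simp only [List.length_cons] at hlt
    obtain ⟨l, hl, hlen, hlm⟩ := fill_b A b hbA hbi hb rest c I hnd (fun v hv => (hmem v hv).2) (by omega)
    have hcA := (hmem c (by simp)).2
    have hdA := (hmem _ (List.getLast_mem (l := c :: rest) (by simp))).2
    have hnot : ∀ v, v ∉ A → v ∈ ({x, y, z, w} : Finset V) → v ∉ l := by
      intro v hv hv' hvl
      rcases hlm v hvl with h | ⟨i, hi, rfl⟩
      · exact hv (hmem v h).2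
      · exact (Finset.mem_filter.1 hi).2 hv'
    have ha1l : a1 ∉ l := by
      intro h
      rcases hlm a1 h with h | ⟨i, hi, rfl⟩
      · exact (hmem a1 h).1 rfl
      · exact hbA i ha1
    have nx := hnot x hx (by simp)
    have ny := hnot y hy (by simp)
    have nz := hnot z hz (by simp)
    have nw := hnot w hw (by simp)
    have hax : a1 ≠ x := by rintro rfl; exact hx ha1
    have hay : a1 ≠ y := by rintro rfl; exact hy ha1
    have haz : z ≠ a1 := by rintro rfl; exact hz ha1
    have haw : w ≠ a1 := by rintro rfl; exact hw ha1
    have s1 := hl.cons (fy c hcA) ny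
    have s2 := s1.cons hxy (by simp [nx, hxy.ne])
    have s3 := s2.cons (fx a1 ha1).symm (by simp [ha1l, hax, hay])
    have s4 := s3.cons (fw a1 ha1) (by simp [nw, haw, h2.symm, h4.symm])
    have s5 := s4.cons hzw (by simp [nz, haz, h1.symm, h3.symm, hzw.ne])
    exact hc (s5.hasCycle (fz _ hdA).symm (by simp) (by simp; omega))

theorem reachA [Fintype V] (h2 : TwoConnected G) (A : Finset V) (hA : A.Nonempty) {y z : V}
    (hy : y ∉ A) (hz : z ∉ A) (hzy : z ≠ y) : ∃ q d R, d ∈ A ∧ LP G z q R ∧ (∀ v ∈ R, v ∉ A) ∧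
      y ∉ R ∧ G.Adj q d := by
  obtain ⟨a0, ha0⟩ := hA
  obtain ⟨l, hl, hyl⟩ := h2.avoid hzy (w := a0) (by rintro rfl; exact hy ha0)
  obtain ⟨l1, d, hd, h1, h3, l2, e⟩ := hl.firstHit (A : Set V) ⟨a0, hl.last_mem, ha0⟩
  have hl1 : l1 ≠ [] := by
    rintro rfl
    have := h1.head
    simp at this
    subst this
    exact hz hd
  obtain ⟨l3, q, rfl⟩ : ∃ l3 w, l1 = l3 ++ [w] :=
    ⟨l1.dropLast, l1.getLast hl1, (List.dropLast_append_getLast hl1).symm⟩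
  have h4 : LP G z d (l3 ++ q :: [d]) := by simpa using h1
  refine ⟨q, d, l3 ++ [q], hd, h4.left_of_append, h3, ?_, h4.right_of_append.chain.rel⟩
  intro h
  apply hyl
  rw [e]
  exact List.mem_append_left _ h

/-- Condition (C2), abstractly. -/
def NoLong (G : SimpleGraph V) (A : Finset V) : Prop :=
  ∀ (f g : V) (L : List V) (a c : V), LP G f g L → (∀ v ∈ L, v ∉ A) → 3 ≤ L.length →
    a ∈ A → c ∈ A → G.Adj a f → G.Adj g c → a = c

theorem caseI [Fintype V] (h2 : TwoConnected G) (A : Finset V) (hC : NoLong G A) {x y z a c : V}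
    (hx : x ∉ A) (hy : y ∉ A) (hz : z ∉ A) (hxz : x ≠ z) (hxy : G.Adj x y) (hyz : G.Adj y z)
    (ha : a ∈ A) (hcA : c ∈ A) (hac : a ≠ c) (hxa : G.Adj x a) (hyc : G.Adj y c) :
    G.Adj z a ∧ (∀ a' ∈ A, G.Adj x a' → a' = a) ∧ (∀ w, w ∉ A → G.Adj x w → w = y) := by
  have hza : G.Adj z a := by
    obtain ⟨q, d, R, hd, hR, hRA, hyR, hqd⟩ := reachA h2 A ⟨a, ha⟩ hy hz hyz.ne.symm
    have hR1 := List.length_pos_iff.2 hR.ne_nil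
    by_cases hxR : x ∈ R
    · exfalso
      obtain ⟨l1, l3, e, h1, -⟩ := hR.split hxR
      have hl1 : l1 ≠ [] := by
        rintro rfl
        have := h1.head
        simp at this
        exact hxz this
      have hl1' := List.length_pos_iff.2 hl1
      have hsub : ∀ v ∈ l1 ++ [x], v ∈ R := by
        intro v hv; rw [e]; simp at hv ⊢; tauto
      have s := h1.cons hyz (fun h => hyR (hsub _ h))
      refine hac (hC _ _ _ a c s.rev ?_ (by simp; omega) ha hcA hxa.symm hyc)
      intro v hv
      have hv : v ∈ y :: (l1 ++ [x]) := List.mem_reverse.1 hv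
      rcases List.mem_cons.1 hv with rfl | hv
      · exact hy
      · exact hRA v (hsub v hv)
    · have s1 := hR.cons hyz hyR
      have hA1 : ∀ v ∈ y :: R, v ∉ A := by
        intro v hv
        rcases List.mem_cons.1 hv with rfl | hv
        · exact hy
        · exact hRA v hv
      have s2 := s1.cons hxy (by simp [hxR, hxy.ne])
      have hda : a = d := hC _ _ _ a d s2 (by
        intro v hv
        rcases List.mem_cons.1 hv with rfl | hv
        · exact hx
        · exact hA1 v hv) (by simp; omega) ha hd hxa.symm hqd
      subst hda
      by_cases hRl : R.length = 1
      · obtain ⟨r, rfl⟩ := List.length_eq_one_iff.1 hRl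
        have i1 := hR.head
        have i2 := hR.last
        simp at i1 i2
        rw [← i1, i2]
        exact hqd
      · exact absurd (hC _ _ _ c a s1 hA1 (by simp; omega) hcA ha hyc.symm hqd) hac.symm
  have hxyz : LP G x z [x, y, z] :=
    (((LP.sing z).cons hyz (by simpa using hyz.ne))).cons hxy (by simp [hxy.ne, hxz])
  refine ⟨hza, ?_, ?_⟩
  · intro a' ha' hxa'
    exact hC _ _ _ a' a hxyz (by simp [hx, hy, hz]) (by simp) ha' ha hxa'.symm hza
  · intro w hw hxw
    by_contra hwy
    by_cases hwz : w = z
    · subst hwz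
      have s : LP G y x [y, w, x] :=
        (((LP.sing x).cons hxw.symm (by simpa using hxz.symm))).cons hyz (by simp [hxy.ne.symm, hyz.ne])
      exact hac.symm (hC _ _ _ c a s (by simp [hx, hy, hz]) (by simp) hcA ha hyc.symm hxa)
    · obtain ⟨q, d, R, hd, hR, hRA, hxR, hqd⟩ := reachA h2 A ⟨a, ha⟩ hx hw hxw.ne.symm
      have hR1 := List.length_pos_iff.2 hR.ne_nil
      by_cases hyR : y ∈ R
      · obtain ⟨l1, l3, e, h1, -⟩ := hR.split hyR
        have hl1 : l1 ≠ [] := by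
          rintro rfl
          have := h1.head
          simp at this
          exact hwy this.symm
        have hl1' := List.length_pos_iff.2 hl1
        have hsub : ∀ v ∈ l1 ++ [y], v ∈ R := by
          intro v hv; rw [e]; simp at hv ⊢; tauto
        have s := h1.cons hxw (fun h => hxR (hsub _ h))
        refine hac (hC _ _ _ a c s ?_ (by simp; omega) ha hcA hxa.symm hyc)
        intro v hv
        rcases List.mem_cons.1 hv with rfl | hv
        · exact hx
        · exact hRA v (hsub v hv)
      · by_cases hzR : z ∈ R
        · obtain ⟨l1, l3, e, h1, -⟩ := hR.split hzR
          have hsub : ∀ v ∈ l1 ++ [z], v ∈ R := by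
            intro v hv; rw [e]; simp at hv ⊢; tauto
          have s := h1.cons hxw (fun h => hxR (hsub _ h))
          have s' := s.cons hxy.symm (by
            intro h
            rcases List.mem_cons.1 h with h | h
            · exact hxy.ne h.symm
            · exact hyR (hsub _ h))
          refine hac.symm (hC _ _ _ c a s' ?_ (by simp) hcA ha hyc.symm hza)
          intro v hv
          rcases List.mem_cons.1 hv with rfl | hv
          · exact hy
          · rcases List.mem_cons.1 hv with rfl | hv
            · exact hx
            · exact hRA v (hsub v hv)
        · have s1 := hR.cons hxw hxR
          have s2 := s1.cons hxy.symm (by simp [hyR, hxy.ne.symm])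
          have hA2 : ∀ v ∈ y :: x :: R, v ∉ A := by
            intro v hv
            rcases List.mem_cons.1 hv with rfl | hv
            · exact hy
            · rcases List.mem_cons.1 hv with rfl | hv
              · exact hx
              · exact hRA v hv
          have s3 := s2.cons hyz.symm (by simp [hzR, hyz.ne.symm, hxz.symm])
          have e1 := hC _ _ _ c d s2 hA2 (by simp; omega) hcA hd hyc.symm hqd
          have e2 := hC _ _ _ a d s3 (by
            intro v hv
            rcases List.mem_cons.1 hv with rfl | hv
            · exact hz
            · exact hA2 v hv) (by simp) ha hd hza.symm hqd
          exact hac (e2.trans e1.symm)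

end Struct


section Struct2

variable {V : Type*} {G : SimpleGraph V}

theorem ABP.strip {X A : Set V} {p a : V} {Q : List V} (h : ABP G X A p a Q) (hp : p ∉ A) :
    ∃ q L, LP G p q L ∧ (∀ v ∈ L, v ∉ A) ∧ G.Adj q a ∧ (∀ v ∈ L, v ∈ Q) := by
  obtain ⟨l1, rfl⟩ := h.lp.eq_concat
  have hl1 : l1 ≠ [] := by
    rintro rfl
    have := h.lp.head
    simp at this
    subst this
    exact hp h.hb
  obtain ⟨l3, q, rfl⟩ : ∃ l3 w, l1 = l3 ++ [w] :=
    ⟨l1.dropLast, l1.getLast hl1, (List.dropLast_append_getLast hl1).symm⟩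
  have h4 : LP G p a (l3 ++ q :: [a]) := by simpa using h.lp
  refine ⟨q, l3 ++ [q], h4.left_of_append, ?_, h4.right_of_append.chain.rel, ?_⟩
  · intro v hv hvA
    have e := h.onlyB v (List.mem_append_left _ hv) hvA
    have nd := h.lp.nodup
    rw [List.nodup_append] at nd
    exact nd.2.2 v hv a (by simp) e
  · intro v hv
    exact List.mem_append_left _ hv

theorem core_xz {A : Finset V} (hC : NoLong G A) {x y z a c q r : V} {L R : List V}
    (hy : y ∉ A) (hxy : G.Adj x y) (hyz : G.Adj y z)
    (hL : LP G x q L) (hR : LP G z r R) (hLA : ∀ v ∈ L, v ∉ A) (hRA : ∀ v ∈ R, v ∉ A)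
    (hyL : y ∉ L) (hyR : y ∉ R) (hd : ∀ v ∈ L, v ∉ R) (ha : a ∈ A) (hcA : c ∈ A)
    (hqa : G.Adj q a) (hrc : G.Adj r c) : a = c := by
  have s1 := hR.cons hyz hyR
  have s2 := hL.rev.join s1 hxy (by
    intro v hv hv'
    have hv := List.mem_reverse.1 hv
    rcases List.mem_cons.1 hv' with rfl | h
    · exact hyL hv
    · exact hd v hv h)
  have l1 := List.length_pos_iff.2 hL.ne_nil
  have l2 := List.length_pos_iff.2 hR.ne_nil
  refine hC _ _ _ a c s2 ?_ (by simp; omega) ha hcA hqa.symm hrc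
  intro v hv
  rcases List.mem_append.1 hv with h | h
  · exact hLA v (List.mem_reverse.1 h)
  · rcases List.mem_cons.1 h with rfl | h
    · exact hy
    · exact hRA v h

theorem core_xy {A : Finset V} (hC : NoLong G A) {x y a c q r : V} {L R : List V}
    (hxy : G.Adj x y)
    (hL : LP G x q L) (hR : LP G y r R) (hLA : ∀ v ∈ L, v ∉ A) (hRA : ∀ v ∈ R, v ∉ A)
    (hd : ∀ v ∈ L, v ∉ R) (ha : a ∈ A) (hcA : c ∈ A) (hac : a ≠ c)
    (hqa : G.Adj q a) (hrc : G.Adj r c) : G.Adj x a ∧ G.Adj y c := by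
  have s2 := hL.rev.join hR hxy (by
    intro v hv hv'
    exact hd v (List.mem_reverse.1 hv) hv')
  have l1 := List.length_pos_iff.2 hL.ne_nil
  have l2 := List.length_pos_iff.2 hR.ne_nil
  have hlen : ¬ 3 ≤ L.length + R.length := by
    intro h3
    refine hac (hC _ _ _ a c s2 ?_ (by simpa using h3) ha hcA hqa.symm hrc)
    intro v hv
    rcases List.mem_append.1 hv with h | h
    · exact hLA v (List.mem_reverse.1 h)
    · exact hRA v h
  obtain ⟨u, rfl⟩ := List.length_eq_one_iff.1 (show L.length = 1 by omega)
  obtain ⟨w, rfl⟩ := List.length_eq_one_iff.1 (show R.length = 1 by omega)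
  have i1 := hL.head
  have i2 := hL.last
  have i3 := hR.head
  have i4 := hR.last
  simp at i1 i2 i3 i4
  subst i1 i2 i3 i4
  exact ⟨hqa, hrc⟩

theorem triple [Fintype V] (h2 : TwoConnected G) (A : Finset V) (hA : 2 ≤ A.card)
    (hC : NoLong G A) {x y z : V}
    (hx : x ∉ A) (hy : y ∉ A) (hz : z ∉ A) (hxz : x ≠ z) (hxy : G.Adj x y) (hyz : G.Adj y z) :
    (∀ w, w ∉ A → G.Adj x w → w = y) ∧ ∃ a, ∀ a' ∈ A, G.Adj x a' → a' = a := by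
  have key : (∃ a c, a ∈ A ∧ c ∈ A ∧ a ≠ c ∧ G.Adj x a ∧ G.Adj y c) ∨
      (∃ a c, a ∈ A ∧ c ∈ A ∧ a ≠ c ∧ G.Adj z a ∧ G.Adj y c) := by
    obtain ⟨a0, ha0, a1, ha1, h01⟩ := Finset.one_lt_card.1 (show 1 < A.card by omega)
    obtain ⟨l, hl, -⟩ := h2.avoid (u := x) (w := a0) (v := y) hxy.ne (by rintro rfl; exact hy ha0)
    have hxX : x ∈ ({x, y, z} : Set V) := by simp
    obtain ⟨p, b, P, hP, -⟩ := hl.toABP hxX (show a0 ∈ (A : Set V) from ha0)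
    obtain ⟨p', a, c, Q1, Q2, hQ1, hQ2, hd, -⟩ := h2.two_paths hP ⟨x, hxX, y, by simp, hxy.ne⟩
      ⟨a0, ha0, a1, ha1, h01⟩
    have hXA : ∀ v ∈ ({x, y, z} : Set V), v ∉ A := by
      rintro v (rfl | rfl | rfl) <;> assumption
    obtain ⟨q, L, hL, hLA, hqa, hLQ⟩ := hQ1.strip (hXA p hQ1.ha)
    obtain ⟨r, R, hR, hRA, hrc, hRQ⟩ := hQ2.strip (hXA p' hQ2.ha)
    have haA : a ∈ A := hQ1.hb
    have hcA : c ∈ A := hQ2.hb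
    have hac : a ≠ c := by
      rintro rfl
      exact hd a hQ1.lp.last_mem hQ2.lp.last_mem
    have hdd : ∀ v ∈ L, v ∉ R := fun v hv hv' => hd v (hLQ v hv) (hRQ v hv')
    have hdd' : ∀ v ∈ R, v ∉ L := fun v hv hv' => hdd v hv' hv
    have hpp : p ≠ p' := by
      rintro rfl
      exact hdd p hL.head_mem hR.head_mem
    have hyL : p ≠ y → y ∉ L := fun h h' => h (hQ1.onlyA y (hLQ y h') (by simp)).symm
    have hyR : p' ≠ y → y ∉ R := fun h h' => h (hQ2.onlyA y (hRQ y h') (by simp)).symm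
    have hp := hQ1.ha
    have hp' := hQ2.ha
    rcases hp with rfl | rfl | rfl
    · rcases hp' with rfl | rfl | rfl
      · exact absurd rfl hpp
      · exact Or.inl ⟨a, c, haA, hcA, hac, core_xy hC hxy hL hR hLA hRA hdd haA hcA hac hqa hrc⟩
      · exact absurd (core_xz hC hy hxy hyz hL hR hLA hRA (hyL hxy.ne) (hyR hyz.ne.symm) hdd haA hcA
          hqa hrc) hac
    · rcases hp' with rfl | rfl | rfl
      · exact Or.inl ⟨c, a, hcA, haA, hac.symm,
          core_xy hC hxy hR hL hRA hLA hdd' hcA haA hac.symm hrc hqa⟩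
      · exact absurd rfl hpp
      · exact Or.inr ⟨c, a, hcA, haA, hac.symm,
          core_xy hC hyz.symm hR hL hRA hLA hdd' hcA haA hac.symm hrc hqa⟩
    · rcases hp' with rfl | rfl | rfl
      · exact absurd (core_xz hC hy hxy hyz hR hL hRA hLA (hyR hxy.ne) (hyL hyz.ne.symm) hdd' hcA haA
          hrc hqa) hac.symm
      · exact Or.inr ⟨a, c, haA, hcA, hac,
          core_xy hC hyz.symm hL hR hLA hRA hdd haA hcA hac hqa hrc⟩
      · exact absurd rfl hpp
  have fin : ∀ a c, a ∈ A → c ∈ A → a ≠ c → G.Adj x a → G.Adj y c → 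
      (∀ w, w ∉ A → G.Adj x w → w = y) ∧ ∃ a, ∀ a' ∈ A, G.Adj x a' → a' = a := by
    intro a c ha hcA hac hxa hyc
    obtain ⟨-, h3, h4⟩ := caseI h2 A hC hx hy hz hxz hxy hyz ha hcA hac hxa hyc
    exact ⟨h4, a, h3⟩
  rcases key with ⟨a, c, ha, hcA, hac, hxa, hyc⟩ | ⟨a, c, ha, hcA, hac, hza, hyc⟩
  · exact fin a c ha hcA hac hxa hyc
  · obtain ⟨hxa, -⟩ := caseI h2 A hC hz hy hx hxz.symm hyz.symm hxy.symm ha hcA hac hza hyc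
    exact fin a c ha hcA hac hxa hyc

theorem degOn_le_card [Finite V] {S : Set V} (B : Finset V) (v : V)
    (h : ∀ w ∈ S, G.Adj v w → w ∈ B) : degOn G S v ≤ B.card := by
  unfold degOn
  rw [← Set.ncard_coe_finset]
  exact Set.ncard_le_ncard (fun w hw => h w hw.1 hw.2) (Set.toFinite _)

theorem half1 [Fintype V] (h2 : TwoConnected G) (A : Finset V) {t : ℕ} (ht : 2 ≤ t) (hAt : A.card = t)
    (hC : NoLong G A) {x y : V} (hx : x ∉ A) (hy : y ∉ A) (hxy : G.Adj x y)
    (hd : t + 1 ≤ degOn G Set.univ x) : ∀ z, z ∉ A → G.Adj y z → z = x := by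
  classical
  intro z hz hyz
  by_contra hne
  obtain ⟨h3, a, h4⟩ := triple h2 A (by omega) hC hx hy hz (fun h => hne h.symm) hxy hyz
  have := degOn_le_card (G := G) (S := Set.univ) {y, a} x (by
    intro w _ hw
    by_cases hwA : w ∈ A
    · simp [h4 w hwA hw]
    · simp [h3 w hwA hw])
  have := Finset.card_le_two (a := y) (b := a)
  omega

theorem half2 [Fintype V] (A : Finset V) {t : ℕ} (hAt : A.card = t)
    {x y : V} (hN : ∀ z, z ∉ A → G.Adj y z → z = x)
    (hd : t + 1 ≤ degOn G Set.univ y) : ∀ a ∈ A, G.Adj y a := by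
  classical
  intro a ha
  by_contra hna
  have := degOn_le_card (G := G) (S := Set.univ) (insert x (A.erase a)) y (by
    intro w _ hw
    by_cases hwA : w ∈ A
    · refine Finset.mem_insert_of_mem (Finset.mem_erase.2 ⟨?_, hwA⟩)
      rintro rfl
      exact hna hw
    · simp [hN w hwA hw])
  have h1 := Finset.card_insert_le x (A.erase a)
  have h2 := Finset.card_erase_of_mem ha
  have h3 := Finset.card_pos.2 ⟨a, ha⟩
  omega

theorem structure2 [Fintype V] (h2 : TwoConnected G) (A : Finset V) {t : ℕ} (ht : 2 ≤ t)
    (hAt : A.card = t) (hC : NoLong G A)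
    (hC3 : ∀ x y z w : V, x ∉ A → y ∉ A → z ∉ A → w ∉ A → G.Adj x y → G.Adj z w →
      (∀ a ∈ A, G.Adj x a) → (∀ a ∈ A, G.Adj y a) → (∀ a ∈ A, G.Adj z a) → (∀ a ∈ A, G.Adj w a) →
      x ≠ z → x ≠ w → y ≠ z → y ≠ w → False) :
    edgeCount G ≤ edgesWithin G (A : Set V) + t * (Fintype.card V - t) ∨
    ∃ x y, x ∉ A ∧ y ∉ A ∧ G.Adj x y ∧ (∀ a ∈ A, G.Adj x a) ∧ (∀ a ∈ A, G.Adj y a) ∧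
      edgeCount G ≤ edgesWithin G (A : Set V) + t * (Fintype.card V - t) + 1 := by
  classical
  let Z : Finset V := Finset.univ.filter (fun v => v ∉ A ∧ t + 1 ≤ degOn G Set.univ v)
  let Lf : Finset V := Finset.univ.filter (fun v => v ∉ A ∧ ¬ t + 1 ≤ degOn G Set.univ v)
  have hZ : ∀ v, v ∈ Z ↔ v ∉ A ∧ t + 1 ≤ degOn G Set.univ v := fun v => by simp [Z]
  have hLf : ∀ v, v ∈ Lf ↔ v ∉ A ∧ ¬ t + 1 ≤ degOn G Set.univ v := fun v => by
    simp only [Lf, Finset.mem_filter, Finset.mem_univ, true_and]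
  have hun : ((A : Set V) ∪ Z) ∪ Lf = Set.univ := by
    ext v
    simp only [Set.mem_union, Finset.mem_coe, hZ, hLf, Set.mem_univ, iff_true]
    tauto
  have hcard : A.card + Z.card + Lf.card = Fintype.card V := by
    rw [← Finset.card_union_of_disjoint, ← Finset.card_union_of_disjoint, ← Finset.card_univ]
    · congr 1
      apply Finset.coe_injective
      push_cast
      exact hun
    · rw [Finset.disjoint_left]
      intro v hv hv'
      rw [hLf] at hv'
      rw [Finset.mem_union, hZ] at hv
      tauto
    · rw [Finset.disjoint_left]
      intro v hv hv'
      rw [hZ] at hv'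
      tauto
  have hLfin : edgeCount G ≤ edgesWithin G ((A : Set V) ∪ Z) + t * Lf.card := by
    rw [← edgesWithin_univ, ← hun]
    apply edges_add
    · intro v hv hv'
      rw [hLf] at hv
      simp only [Set.mem_union, Finset.mem_coe, hZ] at hv'
      tauto
    · intro v hv
      rw [hun]
      have := ((hLf v).1 hv).2
      omega
  have hnt : t * (Fintype.card V - t) = t * Z.card + t * Lf.card := by
    rw [← mul_add]; congr 1; omega
  have hind : ∀ Y : Finset V, Y ⊆ Z → (∀ u ∈ Y, ∀ v ∈ Y, ¬ G.Adj u v) →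
      edgesWithin G ((A : Set V) ∪ Y) ≤ edgesWithin G (A : Set V) + t * Y.card := by
    intro Y hYZ hY
    apply edges_add
    · intro v hv
      exact ((hZ v).1 (hYZ hv)).1
    · intro v hv
      rw [← hAt]
      apply degOn_le_card
      rintro w (hw | hw) hvw
      · exact hw
      · exact absurd hvw (hY v hv w hw)
  by_cases hE : ∃ x ∈ Z, ∃ y ∈ Z, G.Adj x y
  · obtain ⟨x, hx, y, hy, hxy⟩ := hE
    right
    obtain ⟨hxA, hxd⟩ := (hZ x).1 hx
    obtain ⟨hyA, hyd⟩ := (hZ y).1 hy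
    have Ny := half1 h2 A ht hAt hC hxA hyA hxy hxd
    have Nx := half1 h2 A ht hAt hC hyA hxA hxy.symm hyd
    have fx := half2 A hAt Nx hxd
    have fy := half2 A hAt Ny hyd
    refine ⟨x, y, hxA, hyA, hxy, fx, fy, ?_⟩
    have h3 := hind (Z.erase x) (Finset.erase_subset _ _) (by
      intro z hz w hw hzw
      obtain ⟨hzx, hz⟩ := Finset.mem_erase.1 hz
      obtain ⟨hwx, hw⟩ := Finset.mem_erase.1 hw
      obtain ⟨hzA, hzd⟩ := (hZ z).1 hz
      obtain ⟨hwA, hwd⟩ := (hZ w).1 hw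
      have fw := half2 A hAt (half1 h2 A ht hAt hC hzA hwA hzw hzd) hwd
      have fz := half2 A hAt (half1 h2 A ht hAt hC hwA hzA hzw.symm hwd) hzd
      refine hC3 x y z w hxA hyA hzA hwA hxy hzw fx fy fz fw (Ne.symm hzx) (Ne.symm hwx) ?_ ?_
      · rintro rfl
        exact hwx (Ny w hwA hzw)
      · rintro rfl
        exact hzx (Ny z hzA hzw.symm))
    have h4 : edgesWithin G ((A : Set V) ∪ Z) ≤ edgesWithin G ((A : Set V) ∪ (Z.erase x : Finset V))
        + (t + 1) := by
      have e : (A : Set V) ∪ Z = insert x ((A : Set V) ∪ (Z.erase x : Finset V)) := by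
        rw [← Set.union_insert, ← Finset.coe_insert, Finset.insert_erase hx]
      rw [e, peel (by simp [hxA])]
      have h5 := degOn_le_card (G := G) (S := ((A : Set V) ∪ (Z.erase x : Finset V))) (insert y A) x (by
        intro w _ hw
        by_cases hwA : w ∈ A
        · exact Finset.mem_insert_of_mem hwA
        · simp [Nx w hwA hw])
      have := Finset.card_insert_le y A
      omega
    have h5 : (Z.erase x).card + 1 = Z.card := Finset.card_erase_add_one hx
    have h6 : t * Z.card = t * (Z.erase x).card + t := by rw [← h5]; ring
    omega
  · push Not at hE
    left
    have := hind Z subset_rfl hE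
    omega

end Struct2


section Upper

variable {V α : Type*} {G : SimpleGraph V}

theorem edgeCount_comap {t : ℕ} (A : Set V) (g : Fin t → V) (hg : Function.Injective g)
    (hA : Set.range g = A) : edgeCount (G.comap g) = edgesWithin G A := by
  unfold edgeCount edgesWithin
  rw [← Set.ncard_image_of_injective _ (Sym2.map.injective hg)]
  congr 1
  ext e
  constructor
  · rintro ⟨e', he', rfl⟩
    induction e' with
    | _ i j =>
      refine ⟨he', ?_⟩
      intro x hx
      rw [← hA]
      simp only [Sym2.map_mk, Sym2.mem_iff] at hx
      rcases hx with rfl | rfl <;> exact Set.mem_range_self _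
  · rintro ⟨he, hx⟩
    induction e with
    | _ i j =>
      have hi := hx i (by simp)
      have hj := hx j (by simp)
      rw [← hA] at hi hj
      obtain ⟨i', rfl⟩ := hi
      obtain ⟨j', rfl⟩ := hj
      exact ⟨s(i', j'), he, by simp⟩

theorem bdd_ex (n : ℕ) (P : SimpleGraph (Fin n) → Prop) :
    BddAbove {m | ∃ G : SimpleGraph (Fin n), P G ∧ edgeCount G = m} := by
  apply Set.Finite.bddAbove
  apply (Set.finite_range (fun G : SimpleGraph (Fin n) => edgeCount G)).subset
  rintro m ⟨G, -, rfl⟩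
  exact ⟨G, rfl⟩

theorem le_exMax {n : ℕ} {P : SimpleGraph (Fin n) → Prop} {G : SimpleGraph (Fin n)} (h : P G) :
    edgeCount G ≤ exMax n P :=
  le_csSup (bdd_ex n P) ⟨G, h, rfl⟩

theorem embed_cover [Fintype α] {F : SimpleGraph α} {t M : ℕ} (hM : Fintype.card α ≤ M)
    (g : Fin t → V) (hg : Function.Injective g) (b : Fin M → V) (hbi : Function.Injective b)
    (hbg : ∀ i j, b i ≠ g j) (hb : ∀ i j, G.Adj (b i) (g j)) (hF : ¬ ContainsCopy F G) :
    CoverFree F (G.comap g) := by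
  classical
  rintro S hS ⟨f, hf, hfa⟩
  apply hF
  let idx : α → Fin M := fun x => Fin.castLE hM (Fintype.equivFin α x)
  have hidx : Function.Injective idx :=
    (Fin.castLE_injective hM).comp (Fintype.equivFin α).injective
  refine ⟨fun x => if h : x ∈ S then g (f ⟨x, h⟩) else b (idx x), ?_, ?_⟩
  · intro x y hxy
    by_cases hx : x ∈ S <;> by_cases hy : y ∈ S <;> simp only [hx, hy, dif_pos, dif_neg, not_false_eq_true] at hxy
    · exact congrArg Subtype.val (hf (hg hxy))
    · exact absurd hxy.symm (hbg _ _)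
    · exact absurd hxy (hbg _ _)
    · exact hidx (hbi hxy)
  · intro x y hxy
    by_cases hx : x ∈ S <;> by_cases hy : y ∈ S <;> simp only [hx, hy, dif_pos, dif_neg, not_false_eq_true]
    · exact @hfa ⟨x, hx⟩ ⟨y, hy⟩ hxy
    · exact (hb _ _).symm
    · exact hb _ _
    · exact absurd hxy (hS x y hx hy)

theorem embed_edge {F : SimpleGraph α} {t : ℕ}
    (g : Fin t → V) (hg : Function.Injective g) {x y : V} (hxy : G.Adj x y)
    (hxg : ∀ j, x ≠ g j) (hyg : ∀ j, y ≠ g j) (fx : ∀ j, G.Adj x (g j)) (fy : ∀ j, G.Adj y (g j))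
    {u v : α} (huv : F.Adj u v)
    (h : ContainsCopy (F.induce ({u, v}ᶜ : Set α)) (G.comap g)) : ContainsCopy F G := by
  classical
  obtain ⟨f, hf, hfa⟩ := h
  have hm : ∀ w, w ≠ u → w ≠ v → w ∈ ({u, v}ᶜ : Set α) := by
    intro w h1 h2; simp [h1, h2]
  let φ : α → V := fun w => if h1 : w = u then x else if h2 : w = v then y else g (f ⟨w, hm w h1 h2⟩)
  have e1 : φ u = x := by simp [φ]
  have e2 : φ v = y := by simp [φ, huv.ne.symm]
  have e3 : ∀ w (h1 : w ≠ u) (h2 : w ≠ v), φ w = g (f ⟨w, hm w h1 h2⟩) := by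
    intro w h1 h2; simp [φ, h1, h2]
  refine ⟨φ, ?_, ?_⟩
  · intro p q hpq
    by_cases hp : p = u
    · subst hp
      by_cases hq : q = p
      · exact hq.symm
      · by_cases hq' : q = v
        · subst hq'; rw [e1, e2] at hpq; exact absurd hpq hxy.ne
        · rw [e1, e3 q hq hq'] at hpq; exact absurd hpq (hxg _)
    · by_cases hp' : p = v
      · subst hp'
        by_cases hq : q = u
        · subst hq; rw [e1, e2] at hpq; exact absurd hpq hxy.ne.symm
        · by_cases hq' : q = p
          · exact hq'.symm
          · rw [e2, e3 q hq hq'] at hpq; exact absurd hpq (hyg _)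
      · rw [e3 p hp hp'] at hpq
        by_cases hq : q = u
        · subst hq; rw [e1] at hpq; exact absurd hpq.symm (hxg _)
        · by_cases hq' : q = v
          · subst hq'; rw [e2] at hpq; exact absurd hpq.symm (hyg _)
          · rw [e3 q hq hq'] at hpq
            exact congrArg Subtype.val (hf (hg hpq))
  · intro p q hpq
    by_cases hp : p = u
    · subst hp
      have hq := hpq.ne.symm
      by_cases hq' : q = v
      · subst hq'; rw [e1, e2]; exact hxy
      · rw [e1, e3 q hq hq']; exact fx _
    · by_cases hp' : p = v
      · subst hp'
        have hq' := hpq.ne.symm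
        by_cases hq : q = u
        · subst hq; rw [e1, e2]; exact hxy.symm
        · rw [e2, e3 q hq hq']; exact fy _
      · rw [e3 p hp hp']
        by_cases hq : q = u
        · subst hq; rw [e1]; exact (fx _).symm
        · by_cases hq' : q = v
          · subst hq'; rw [e2]; exact (fy _).symm
          · rw [e3 q hq hq']
            exact @hfa ⟨p, hm p hp hp'⟩ ⟨q, hm q hq hq'⟩ hpq

theorem upper [Fintype V] [Fintype α] {F : SimpleGraph α} {t : ℕ} (ht : 2 ≤ t)
    (hEX : ∀ T : SimpleGraph (Fin t), CoverFree F T →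
      edgeCount T = exMax t (CoverFree F) →
      ∃ u v, F.Adj u v ∧ ContainsCopy (F.induce ({u, v}ᶜ : Set α)) T)
    (h2 : TwoConnected G) (hc : ¬ HasCycleGE G (2 * t + 2)) (hF : ¬ ContainsCopy F G)
    (hN : N1 t (t + 5 + Fintype.card α) ≤ Fintype.card V) :
    edgeCount G ≤ exMax t (CoverFree F) + t * (Fintype.card V - t) := by
  classical
  by_cases he : t * Fintype.card V ≤ edgeCount G + t * t
  · obtain ⟨A, K, b, hAt, hKA, hKd, hcl, hbK, hb⟩ :=
      structure1 (by omega) (t + 5 + Fintype.card α) (by omega) h2 hc hN he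
    have hbA : ∀ i, b i ∉ A := fun i => hKA i _ (hbK i)
    have hbi : Function.Injective b := by
      intro i j hij
      by_contra h
      exact Set.disjoint_left.1 (hKd i j h) (hbK i) (hij ▸ hbK j)
    have hC : NoLong G A := by
      intro f g L a c hL hLA hL3 ha hcA haf hgc
      exact C2 (by omega) hc A hAt K b hKA hKd hcl hbK hb hL hLA hL3 ha hcA haf hgc
    let e := A.equivFinOfCardEq hAt
    let g : Fin t → V := fun i => (e.symm i : V)
    have hg : Function.Injective g := Subtype.val_injective.comp e.symm.injective
    have hgA : ∀ i, g i ∈ A := fun i => (e.symm i).2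
    have hrange : Set.range g = (A : Set V) := by
      ext v
      constructor
      · rintro ⟨i, rfl⟩; exact hgA i
      · intro hv
        exact ⟨e ⟨v, hv⟩, by simp [g]⟩
    have hne : ∀ v, v ∉ A → ∀ j, v ≠ g j := by
      rintro v hv j rfl
      exact hv (hgA j)
    have hT : CoverFree F (G.comap g) := embed_cover (by omega) g hg b hbi (fun i => hne _ (hbA i))
      (fun i j => hb i _ (hgA j)) hF
    have hTe := edgeCount_comap (G := G) (A : Set V) g hg hrange
    have hle := le_exMax hT
    rcases structure2 h2 A ht hAt hC (by
      intro x y z w hx hy hz hw hxy hzw fx fy fz fw i1 i2 i3 i4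
      exact C3 ht (by omega) hc A hAt b hbA hbi hb hx hy hz hw hxy hzw fx fy fz fw i1 i2 i3 i4) with h | ⟨x, y, hx, hy, hxy, fx, fy, h⟩
    · omega
    · by_cases heq : edgeCount (G.comap g) = exMax t (CoverFree F)
      · obtain ⟨u, v, huv, hcp⟩ := hEX _ hT heq
        exact absurd (embed_edge g hg hxy (hne x hx) (hne y hy) (fun j => fx _ (hgA j))
          (fun j => fy _ (hgA j)) huv hcp) hF
      · omega
  · rw [Nat.mul_sub]
    omega

end Upper


section Lower

variable {V α : Type*}

/-- The join of `T`, placed on the range of `g`, with an independent set on the other vertices. -/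
def joinOn {t : ℕ} (T : SimpleGraph (Fin t)) (g : Fin t → V) (hg : Function.Injective g) :
    SimpleGraph V where
  Adj x y := (∃ i j, x = g i ∧ y = g j ∧ T.Adj i j) ∨ (x ∈ Set.range g ∧ y ∉ Set.range g) ∨
    (x ∉ Set.range g ∧ y ∈ Set.range g)
  symm := ⟨by
    rintro x y (⟨i, j, h1, h2, h3⟩ | ⟨h1, h2⟩ | ⟨h1, h2⟩)
    · exact Or.inl ⟨j, i, h2, h1, h3.symm⟩
    · exact Or.inr (Or.inr ⟨h2, h1⟩)
    · exact Or.inr (Or.inl ⟨h2, h1⟩)⟩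
  loopless := ⟨by
    rintro x (⟨i, j, h1, h2, h3⟩ | ⟨h1, h2⟩ | ⟨h1, h2⟩)
    · exact h3.ne (hg (h1.symm.trans h2))
    · exact h2 h1
    · exact h1 h2⟩

variable {t : ℕ} {T : SimpleGraph (Fin t)} {g : Fin t → V} {hg : Function.Injective g}

theorem joinOn_comap : (joinOn T g hg).comap g = T := by
  ext i j
  constructor
  · rintro (⟨i', j', h1, h2, h3⟩ | ⟨h1, h2⟩ | ⟨h1, h2⟩)
    · rw [hg h1, hg h2]; exact h3
    · exact absurd (Set.mem_range_self _) h2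
    · exact absurd (Set.mem_range_self _) h1
  · intro h
    exact Or.inl ⟨i, j, rfl, rfl, h⟩

theorem joinOn_indep {x y : V} (hx : x ∉ Set.range g) (hy : y ∉ Set.range g) :
    ¬ (joinOn T g hg).Adj x y := by
  rintro (⟨i', j', h1, h2, h3⟩ | ⟨h1, h2⟩ | ⟨h1, h2⟩)
  · exact hx ⟨i', h1.symm⟩
  · exact hx h1
  · exact hy h2

theorem joinOn_edges [Fintype V] :
    edgeCount T + t * (Fintype.card V - t) ≤ edgeCount (joinOn T g hg) := by
  classical
  have h1 := edgeCount_comap (G := joinOn T g hg) (Set.range g) g hg rfl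
  rw [joinOn_comap] at h1
  let B : Finset V := Finset.univ.filter (fun v => v ∉ Set.range g)
  have hB : ∀ v, v ∈ B ↔ v ∉ Set.range g := fun v => by simp [B]
  have hrc : (Set.range g).ncard = t := by
    rw [← Set.image_univ, Set.ncard_image_of_injective _ hg, Set.ncard_univ]; simp
  have h2 := edges_add_ge (G := joinOn T g hg) (c := t) (S := Set.range g) B
    (fun v hv => (hB v).1 hv) (by
      intro v hv
      unfold degOn
      conv_lhs => rw [← hrc]
      apply Set.ncard_le_ncard _ (Set.toFinite _)
      intro w hw
      exact ⟨hw, Or.inr (Or.inr ⟨(hB v).1 hv, hw⟩)⟩)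
  have h3 : Set.range g ∪ (B : Set V) = Set.univ := by
    ext v
    simp only [Set.mem_union, Finset.mem_coe, hB, Set.mem_univ, iff_true]
    tauto
  rw [h3, edgesWithin_univ] at h2
  have h4 : B.card = Fintype.card V - t := by
    have e : B = (Finset.univ.image g)ᶜ := by
      ext v; rw [hB]; simp
    rw [e, Finset.card_compl, Finset.card_image_of_injective _ hg]; simp
  rw [h4] at h2
  omega

theorem conn_of {W : Type*} (H : SimpleGraph W) (A : Set W) {a b : W} (ha : a ∈ A) (hb : b ∉ A)
    (h : ∀ x ∈ A, ∀ y, y ∉ A → H.Adj x y) : H.Connected := by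
  have key : ∀ w, H.Reachable w a := by
    intro w
    by_cases hw : w ∈ A
    · exact (h w hw b hb).reachable.trans (h a ha b hb).symm.reachable
    · exact (h a ha w hw).symm.reachable
  have : Nonempty W := ⟨a⟩
  exact ⟨fun u v => (key u).trans (key v).symm⟩

theorem joinOn_two [Fintype V] (ht : 2 ≤ t) (hn : t + 2 ≤ Fintype.card V) :
    TwoConnected (joinOn T g hg) := by
  classical
  have hA : ∀ x ∈ Set.range g, ∀ y, y ∉ Set.range g → (joinOn T g hg).Adj x y :=
    fun x hx y hy => Or.inr (Or.inl ⟨hx, hy⟩)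
  have ha : ∀ v, ∃ a ∈ Set.range g, a ≠ v := by
    intro v
    by_contra hcon
    push Not at hcon
    have h0 := hcon (g ⟨0, by omega⟩) (Set.mem_range_self _)
    have h1 := hcon (g ⟨1, by omega⟩) (Set.mem_range_self _)
    have := hg (h0.trans h1.symm)
    simp at this
  have hb : ∀ v, ∃ b, b ∉ Set.range g ∧ b ≠ v := by
    intro v
    by_contra hcon
    push Not at hcon
    have h1 : (Finset.univ : Finset V) ⊆ insert v (Finset.univ.image g) := by
      intro w _
      by_cases hw : w ∈ Set.range g
      · obtain ⟨i, rfl⟩ := hw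
        simp
      · simp [hcon w hw]
    have h2 := Finset.card_le_card h1
    have h3 := Finset.card_insert_le v (Finset.univ.image g)
    have h4 := Finset.card_image_le (s := Finset.univ) (f := g)
    rw [Finset.card_univ] at h2
    rw [Finset.card_univ, Fintype.card_fin] at h4
    omega
  refine ⟨by omega, ?_, ?_⟩
  · obtain ⟨a, ha, -⟩ := ha (g ⟨0, by omega⟩)
    obtain ⟨b, hb, -⟩ := hb (g ⟨0, by omega⟩)
    exact conn_of _ (Set.range g) ha hb hA
  · intro v
    obtain ⟨a, ha, hav⟩ := ha v
    obtain ⟨b, hb, hbv⟩ := hb v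
    exact conn_of _ {x | x.1 ∈ Set.range g} (a := ⟨a, hav⟩) (b := ⟨b, hbv⟩) ha hb
      (fun x hx y hy => hA x hx y hy)

theorem chain_count [DecidableEq V] {G : SimpleGraph V} (A : Finset V)
    (hA : ∀ x y, x ∉ A → y ∉ A → ¬ G.Adj x y) : ∀ l : List V, l.IsChain G.Adj →
      l.length ≤ 2 * (l.filter (· ∈ A)).length + 1
  | [], _ => by simp
  | [a], _ => by simp
  | a :: b :: l, h => by
    have hab : G.Adj a b := by simp at h; exact h.1
    have h1 : (b :: l).IsChain G.Adj := h.tail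
    have h2 : l.IsChain G.Adj := h1.tail
    by_cases ha : a ∈ A
    · have := chain_count A hA (b :: l) h1
      rw [List.filter_cons_of_pos (by simpa using ha)]
      simp only [List.length_cons] at this ⊢
      omega
    · have hb : b ∈ A := by
        by_contra hb
        exact hA a b ha hb hab
      have := chain_count A hA l h2
      rw [List.filter_cons_of_neg (by simpa using ha), List.filter_cons_of_pos (by simpa using hb)]
      simp only [List.length_cons] at this ⊢
      omega

theorem joinOn_cycle : ¬ HasCycleGE (joinOn T g hg) (2 * t + 2) := by
  classical
  intro h
  obtain ⟨u, v, l, hl, -, -, hlen⟩ := h.exists_list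
  have h1 := chain_count (G := joinOn T g hg) (Finset.univ.image g) (by
    intro x y hx hy
    apply joinOn_indep
    · simpa using hx
    · simpa using hy) l hl.chain
  have h2 : (l.filter (· ∈ Finset.univ.image g)).length ≤ t := by
    rw [← List.toFinset_card_of_nodup (hl.nodup.filter _)]
    have h3 : (l.filter (· ∈ Finset.univ.image g)).toFinset ⊆ Finset.univ.image g := by
      intro x hx
      have := List.mem_toFinset.1 hx
      simpa using (List.mem_filter.1 this).2
    have h4 := Finset.card_le_card h3
    have h5 := Finset.card_image_le (s := Finset.univ) (f := g)
    rw [Finset.card_univ, Fintype.card_fin] at h5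
    omega
  omega

theorem joinOn_free {F : SimpleGraph α} (hT : CoverFree F T) :
    ¬ ContainsCopy F (joinOn T g hg) := by
  rintro ⟨f, hf, hfa⟩
  refine hT {x | f x ∈ Set.range g} ?_ ?_
  · intro x y hx hy hxy
    exact joinOn_indep hx hy (hfa hxy)
  · have hch : ∀ x : {x | f x ∈ Set.range g}, ∃ i, g i = f x := fun x => x.2
    choose p hp using hch
    refine ⟨p, ?_, ?_⟩
    · intro x y hxy
      apply Subtype.ext
      apply hf
      rw [← hp x, ← hp y, hxy]
    · intro x y hxy
      have h : (joinOn T g hg).Adj (f x) (f y) := hfa hxy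
      rw [← hp x, ← hp y] at h
      rw [← joinOn_comap (T := T) (g := g) (hg := hg)]
      exact h

theorem bot_free [Fintype α] {F : SimpleGraph α} (hp : PGE F (t + 1)) :
    CoverFree F (⊥ : SimpleGraph (Fin t)) := by
  classical
  rintro S hS ⟨f, hf, hfa⟩
  have h1 := (hp (fun a => decide (a ∈ S)) (by
    intro a b hab heq
    have heq : (a ∈ S) ↔ (b ∈ S) := by simpa using heq
    by_cases ha : a ∈ S
    · exact @hfa ⟨a, ha⟩ ⟨b, heq.1 ha⟩ hab
    · exact hS a b ha (fun h => ha (heq.2 h)) hab)).1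
  have h2 : {a | decide (a ∈ S) = true} = S := by ext; simp
  rw [h2] at h1
  have h3 := Nat.card_le_card_of_injective f hf
  rw [Nat.card_coe_set_eq] at h3
  simp at h3
  omega

theorem ex_attained [Fintype α] {F : SimpleGraph α} (hp : PGE F (t + 1)) :
    ∃ T : SimpleGraph (Fin t), CoverFree F T ∧ edgeCount T = exMax t (CoverFree F) :=
  Nat.sSup_mem (s := {m | ∃ G : SimpleGraph (Fin t), CoverFree F G ∧ edgeCount G = m})
    ⟨_, ⊥, bot_free hp, rfl⟩ (bdd_ex t _)

theorem main_t [Fintype α] {F : SimpleGraph α} (ht : 2 ≤ t) (hpF : PGE F (t + 1))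
    (hEX : ∀ T : SimpleGraph (Fin t), CoverFree F T →
      edgeCount T = exMax t (CoverFree F) →
      ∃ u v, F.Adj u v ∧ ContainsCopy (F.induce ({u, v}ᶜ : Set α)) T) :
    ∃ N : ℕ, ∀ n : ℕ, N ≤ n →
      exMax n (fun G => TwoConnected G ∧ ¬ HasCycleGE G (2 * t + 2) ∧ ¬ ContainsCopy F G)
        = exMax t (CoverFree F) + t * (n - t) := by
  refine ⟨N1 t (t + 5 + Fintype.card α) + (t + 2), ?_⟩
  intro n hn
  obtain ⟨T, hT, hTe⟩ := ex_attained hpF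
  have hgood : (fun G : SimpleGraph (Fin n) => TwoConnected G ∧ ¬ HasCycleGE G (2 * t + 2) ∧
      ¬ ContainsCopy F G) (joinOn T (Fin.castLE (show t ≤ n by omega)) (Fin.castLE_injective _)) :=
    ⟨joinOn_two ht (by rw [Fintype.card_fin]; omega), joinOn_cycle, joinOn_free hT⟩
  apply le_antisymm
  · unfold exMax
    refine csSup_le ⟨_, _, hgood, rfl⟩ ?_
    rintro m ⟨G, ⟨h2, hc, hF⟩, rfl⟩
    have := upper ht hEX h2 hc hF (by rw [Fintype.card_fin]; omega)
    rwa [Fintype.card_fin] at this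
  · refine le_trans ?_ (le_exMax hgood)
    have := joinOn_edges (T := T) (g := Fin.castLE (show t ≤ n by omega))
      (hg := Fin.castLE_injective _)
    rw [Fintype.card_fin, hTe] at this
    exact this

end Lower

/-- Dou–Hu–Peng, Theorem 4 (even case, `ℓ = 0`): if moreover every extremal
graph in `EX(t, 𝓗)` contains a member of `𝓗' = {F − {u,v} : uv ∈ E(F)}`, then
`ex_{2-conn}(n, {𝓒_{≥k}, F}) = ex(t, 𝓗) + t(n - t)` for all large `n`. -/
theorem stmt2 {α : Type*} [Fintype α] (k : ℕ) (hk : 6 ≤ k) (hkeven : Even k)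
    (F : SimpleGraph α) (hpF : PGE F ((k - 2) / 2 + 1))
    (hEX : ∀ T : SimpleGraph (Fin ((k - 2) / 2)), CoverFree F T →
      edgeCount T = exMax ((k - 2) / 2) (CoverFree F) →
      ∃ u v, F.Adj u v ∧ ContainsCopy (F.induce ({u, v}ᶜ : Set α)) T) :
    ∃ N : ℕ, ∀ n : ℕ, N ≤ n →
      exMax n (fun G => TwoConnected G ∧ ¬ HasCycleGE G k ∧ ¬ ContainsCopy F G)
        = exMax ((k - 2) / 2) (CoverFree F)
          + ((k - 2) / 2) * (n - (k - 2) / 2) := by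
  obtain ⟨m, rfl⟩ := hkeven
  obtain ⟨t, rfl⟩ : ∃ t, m = t + 1 := ⟨m - 1, by omega⟩
  generalize hs : (t + 1 + (t + 1) - 2) / 2 = s at hpF hEX ⊢
  obtain rfl : s = t := by omega
  have e2 : s + 1 + (s + 1) = 2 * s + 2 := by ring
  rw [e2]
  exact main_t (by omega) hpF hEX
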